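/- There is a constant c > 0 such that for every sign s ∈ {+1,−1} and every Schwartz function f on ℝ×ℝ², ‖f‖_{L³_t L⁶_x} ≤ c ‖f‖_{X^{1/2,1/3,1}_s} = c ∑_{k≥0} 2^{k/3} ‖⟨ξ⟩^{1/2} φ̂_k(τ + s|ξ|) f̃(τ,ξ)‖_{L²_{τ,ξ}}. -/

import Mathlib

open MeasureTheory Complex
open scoped RealInnerProductSpace

noncomputable section

/-- ℝ² with the Euclidean norm. -/
abbrev E2 : Type := EuclideanSpace ℝ (Fin 2)

/-- Space-time ℝ × ℝ². -/
abbrev SpaceTime : Type := ℝ × E2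

/-- Space–time Fourier transform f̃(τ,ξ). -/
def ftST (f : SpaceTime → ℂ) (τ : ℝ) (ξ : E2) : ℂ :=
  ∫ p : SpaceTime, Complex.exp (-Complex.I * ((p.1 * τ + ⟪p.2, ξ⟫ : ℝ) : ℂ)) * f p

/-- Spatial Fourier transform. -/
def ftX (f : E2 → ℂ) (ξ : E2) : ℂ :=
  ∫ x : E2, Complex.exp (-Complex.I * ((⟪x, ξ⟫ : ℝ) : ℂ)) * f x

/-- Japanese bracket ⟨x⟩ = (1+x²)^{1/2}. -/
def jap (x : ℝ) : ℝ := Real.sqrt (1 + x ^ 2)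

/-- L² norm in the Fourier variables (τ,ξ). -/
def l2F (g : ℝ → E2 → ℂ) : ℝ := Real.sqrt (∫ τ : ℝ, ∫ ξ : E2, ‖g τ ξ‖ ^ 2)

/-- Classical wave-Bourgain norm ‖f‖_{X^{a,b}_s}. -/
def Xnorm (a b s : ℝ) (f : SpaceTime → ℂ) : ℝ :=
  l2F fun τ ξ => ((jap ‖ξ‖ ^ a * jap (τ + s * ‖ξ‖) ^ b : ℝ) : ℂ) * ftST f τ ξ

/-- The hypotheses on the Littlewood–Paley bump function φ. -/
structure IsLPBump (φ : ℝ → ℝ) : Prop where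
  smooth : ContDiff ℝ (⊤ : ℕ∞) φ
  compactSupport : HasCompactSupport φ
  nonneg : ∀ τ, 0 ≤ φ τ
  support_subset : ∀ τ, φ τ ≠ 0 → 1 / 2 ≤ |τ| ∧ |τ| ≤ 2
  pos : ∀ τ, 1 / Real.sqrt 2 ≤ |τ| → |τ| ≤ Real.sqrt 2 → 0 < φ τ

/-- ∑_{j∈ℤ} φ(2^{−j}τ). -/
def lpSum (φ : ℝ → ℝ) (τ : ℝ) : ℝ := ∑' j : ℤ, φ (τ / 2 ^ j)

/-- The Littlewood–Paley pieces φ̂_k: φ̂_k(τ) = φ(2^{−k}τ)/∑_{j∈ℤ}φ(2^{−j}τ) for k ≥ 1,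
    φ̂_0 = 1 − ∑_{k≥1} φ̂_k. -/
def lpPiece (φ : ℝ → ℝ) : ℕ → ℝ → ℝ
  | 0, τ => 1 - ∑' k : ℕ, φ (τ / 2 ^ (k + 1)) / lpSum φ τ
  | k + 1, τ => φ (τ / 2 ^ (k + 1)) / lpSum φ τ

/-- Bourgain–Besov norm ‖f‖_{X^{a,b,1}_s}. -/
def XnormB (φ : ℝ → ℝ) (a b s : ℝ) (f : SpaceTime → ℂ) : ℝ :=
  ∑' k : ℕ, (2 : ℝ) ^ (b * k) *
    l2F fun τ ξ => ((jap ‖ξ‖ ^ a * lpPiece φ k (τ + s * ‖ξ‖) : ℝ) : ℂ) * ftST f τ ξ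

/-- Bourgain–Besov norm ‖f‖_{X^{a,b,∞}_s}. -/
def XnormBinf (φ : ℝ → ℝ) (a b s : ℝ) (f : SpaceTime → ℂ) : ℝ :=
  ⨆ k : ℕ, (2 : ℝ) ^ (b * k) *
    l2F fun τ ξ => ((jap ‖ξ‖ ^ a * lpPiece φ k (τ + s * ‖ξ‖) : ℝ) : ℂ) * ftST f τ ξ

/-- Mixed norm ‖f‖_{L^q_t L^r_x}. -/
def mixedNorm (q r : ℝ) (f : SpaceTime → ℂ) : ℝ :=
  (∫ t : ℝ, (∫ x : E2, ‖f (t, x)‖ ^ r) ^ (q / r)) ^ (1 / q)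

/-- L² norm on the slab [0,T] × ℝ². -/
def l2Slab (T : ℝ) (f : SpaceTime → ℂ) : ℝ :=
  Real.sqrt (∫ t in Set.Icc (0 : ℝ) T, ∫ x : E2, ‖f (t, x)‖ ^ 2)

open scoped ENNReal ComplexConjugate

/-- The `T T*` inequality on a finite measure space, with a weight `ω` dominating the support. -/
lemma lintegral_enorm_sq_le_of_kernel_finite {X P : Type*} [MeasurableSpace X] [MeasurableSpace P]
    {μ : Measure X} [IsFiniteMeasure μ] {ρ : Measure P} [SFinite ρ]
    {e : X → P → ℂ} (he : Measurable (Function.uncurry e)) (hb : ∀ x p, ‖e x p‖ ≤ 1)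
    {κ : X → X → ℝ≥0∞} (hκm : Measurable (Function.uncurry κ)) (hκs : ∀ x y, κ x y = κ y x)
    {A : ℝ} (hA : 0 < A) (hκ : ∀ x, ∫⁻ y, κ x y ∂μ ≤ ENNReal.ofReal A)
    {ω : P → ℝ} (hω0 : ∀ p, 0 ≤ ω p) (hωi : Integrable ω ρ)
    (hK : ∀ x y, ‖∫ p, e x p * conj (e y p) * ω p ∂ρ‖ₑ ≤ κ x y)
    {g : P → ℂ} (hg : Measurable g) (hgi : Integrable g ρ) {m : ℝ} (hm : 0 < m)
    (hgω : ∀ᵐ p ∂ρ, g p ≠ 0 → m ≤ ω p) :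
    ∫⁻ x, ‖∫ p, e x p * g p ∂ρ‖ₑ ^ 2 ∂μ
      ≤ ENNReal.ofReal (A / m) * ∫⁻ p, ‖g p‖ₑ ^ 2 ∂ρ := by
  set F : X → ℂ := fun x => ∫ p, e x p * g p ∂ρ with hF
  have hFm : Measurable F := by
    have : StronglyMeasurable (Function.uncurry fun x p => e x p * g p) :=
      (he.mul (hg.comp measurable_snd)).stronglyMeasurable
    exact this.integral_prod_right.measurable
  set B : ℝ := ∫ p, ‖g p‖ ∂ρ with hB
  have hFB : ∀ x, ‖F x‖ ≤ B := fun x => by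
    refine norm_integral_le_of_norm_le hgi.norm (ae_of_all _ fun p => ?_)
    rw [norm_mul]
    exact mul_le_of_le_one_left (norm_nonneg _) (hb x p)
  have hB0 : 0 ≤ B := integral_nonneg fun p => norm_nonneg _
  set H : P → ℂ := fun p => ∫ x, conj (F x) * e x p ∂μ with hH
  have hcF : Measurable fun x => conj (F x) := Complex.continuous_conj.measurable.comp hFm
  have hHm : Measurable H := by
    have : StronglyMeasurable (Function.uncurry fun p x => conj (F x) * e x p) :=
      ((hcF.comp measurable_snd).mul (he.comp measurable_swap)).stronglyMeasurable
    exact this.integral_prod_right.measurable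
  set Q : ℝ≥0∞ := ∫⁻ x, ‖F x‖ₑ ^ 2 ∂μ with hQ
  have hQfin : Q ≠ ∞ := by
    have : Q ≤ ∫⁻ x, (ENNReal.ofReal B) ^ 2 ∂μ := by
      refine lintegral_mono fun x => ?_
      gcongr
      rw [← ofReal_norm]
      exact ENNReal.ofReal_le_ofReal (hFB x)
    refine ne_top_of_le_ne_top ?_ this
    simp [ENNReal.mul_eq_top, measure_ne_top]
  have hQ1 : Q ≤ ∫⁻ p, ‖H p‖ₑ * ‖g p‖ₑ ∂ρ := by
    have hwt : Integrable (Function.uncurry fun x p => conj (F x) * (e x p * g p)) (μ.prod ρ) := by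
      have h1 : Integrable (fun z : X × P => B * ‖g z.2‖) (μ.prod ρ) :=
        (hgi.norm.comp_snd μ).const_mul B
      refine h1.mono' ?_ (ae_of_all _ fun z => ?_)
      · exact ((hcF.comp measurable_fst).mul
          (he.mul (hg.comp measurable_snd))).aestronglyMeasurable
      · simp only [Function.uncurry, norm_mul, RCLike.norm_conj]
        exact mul_le_mul (hFB _) (mul_le_of_le_one_left (norm_nonneg _) (hb _ _))
          (by positivity) hB0
    have e1 : ∫ x, conj (F x) * F x ∂μ = ∫ p, H p * g p ∂ρ := by
      calc ∫ x, conj (F x) * F x ∂μ = ∫ x, ∫ p, conj (F x) * (e x p * g p) ∂ρ ∂μ := by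
            simp_rw [integral_const_mul]; rfl
        _ = ∫ p, ∫ x, conj (F x) * (e x p * g p) ∂μ ∂ρ := integral_integral_swap hwt
        _ = ∫ p, H p * g p ∂ρ := by
            simp_rw [← mul_assoc, integral_mul_const]; rfl
    have e2 : Q = ‖∫ x, conj (F x) * F x ∂μ‖ₑ := by
      have h3 : ∀ x, conj (F x) * F x = ((‖F x‖ ^ 2 : ℝ) : ℂ) := fun x => by
        rw [Complex.conj_mul']; push_cast; rfl
      simp_rw [h3]
      rw [integral_complex_ofReal, ← ofReal_norm, Complex.norm_real, Real.norm_of_nonneg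
        (integral_nonneg fun _ => by positivity), ofReal_integral_eq_lintegral_ofReal]
      · refine lintegral_congr fun x => ?_
        rw [ENNReal.ofReal_pow (norm_nonneg _), ofReal_norm]
      · refine Integrable.of_bound (hFm.norm.pow_const 2).aestronglyMeasurable (B ^ 2)
          (ae_of_all _ fun x => ?_)
        rw [Real.norm_of_nonneg (by positivity)]
        gcongr
        exact hFB x
      · exact ae_of_all _ fun _ => by positivity
    rw [e2, e1]
    refine (enorm_integral_le_lintegral_enorm _).trans (le_of_eq ?_)
    simp only [enorm_mul]
  have hQ2 : ∫⁻ p, ENNReal.ofReal (ω p) * ‖H p‖ₑ ^ 2 ∂ρ ≤ ENNReal.ofReal A * Q := by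
    have hHb : ∀ p, ‖H p‖ ≤ B * μ.real Set.univ := fun p => by
      refine norm_integral_le_of_norm_le_const (ae_of_all _ fun x => ?_)
      rw [norm_mul, RCLike.norm_conj]
      exact (mul_le_of_le_one_right (norm_nonneg _) (hb _ _)).trans (hFB x)
    have e1 : ∫⁻ p, ENNReal.ofReal (ω p) * ‖H p‖ₑ ^ 2 ∂ρ
        = ‖∫ p, H p * conj (H p) * ω p ∂ρ‖ₑ := by
      have h3 : ∀ p, H p * conj (H p) * ω p = ((ω p * ‖H p‖ ^ 2 : ℝ) : ℂ) := fun x => by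
        rw [Complex.mul_conj']; push_cast; ring
      simp_rw [h3]
      rw [integral_complex_ofReal, ← ofReal_norm, Complex.norm_real, Real.norm_of_nonneg
        (integral_nonneg fun p => mul_nonneg (hω0 p) (by positivity)),
        ofReal_integral_eq_lintegral_ofReal]
      · refine lintegral_congr fun x => ?_
        rw [ENNReal.ofReal_mul (hω0 x), ENNReal.ofReal_pow (norm_nonneg _), ofReal_norm]
      · refine Integrable.mono' (hωi.mul_const ((B * μ.real Set.univ) ^ 2))
          (hωi.aestronglyMeasurable.mul (hHm.norm.pow_const 2).aestronglyMeasurable)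
          (ae_of_all _ fun x => ?_)
        rw [Real.norm_of_nonneg (mul_nonneg (hω0 _) (by positivity))]
        have := hω0 x
        gcongr
        exact hHb x
      · exact ae_of_all _ fun p => mul_nonneg (hω0 p) (by positivity)
    have e2 : ∫ p, H p * conj (H p) * ω p ∂ρ
        = ∫ z : X × X, conj (F z.1) * F z.2 * ∫ p, e z.1 p * conj (e z.2 p) * ω p ∂ρ
            ∂(μ.prod μ) := by
      have hwt : Integrable (Function.uncurry fun (p : P) (z : X × X) =>
          (conj (F z.1) * e z.1 p) * (F z.2 * conj (e z.2 p)) * ω p) (ρ.prod (μ.prod μ)) := by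
        have h1 : Integrable (fun z : P × (X × X) => ω z.1 * B ^ 2) (ρ.prod (μ.prod μ)) :=
          (hωi.comp_fst _).mul_const _
        refine h1.mono' ?_ (ae_of_all _ fun z => ?_)
        · refine AEStronglyMeasurable.mul (Measurable.aestronglyMeasurable ?_) ?_
          · have hm1 : Measurable fun z : P × (X × X) => e z.2.1 z.1 :=
              he.comp (measurable_snd.fst.prodMk measurable_fst)
            have hm2 : Measurable fun z : P × (X × X) => e z.2.2 z.1 :=
              he.comp (measurable_snd.snd.prodMk measurable_fst)
            exact ((hcF.comp measurable_snd.fst).mul hm1).mul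
              ((hFm.comp measurable_snd.snd).mul (Complex.continuous_conj.measurable.comp hm2))
          · exact Complex.continuous_ofReal.comp_aestronglyMeasurable
              (hωi.aestronglyMeasurable.comp_fst)
        · simp only [Function.uncurry, norm_mul, RCLike.norm_conj, Complex.norm_real,
            Real.norm_of_nonneg (hω0 _)]
          rw [mul_comm, sq]
          have h1 := fun x p => mul_le_mul (hFB x) (hb x p) (norm_nonneg _) hB0
          simp only [mul_one] at h1
          exact mul_le_mul_of_nonneg_left (mul_le_mul (h1 _ _) (h1 _ _) (by positivity) hB0)
            (hω0 _)
      calc ∫ p, H p * conj (H p) * ω p ∂ρ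
          = ∫ p, ∫ z : X × X, (conj (F z.1) * e z.1 p) * (F z.2 * conj (e z.2 p)) * ω p
              ∂(μ.prod μ) ∂ρ := by
            refine integral_congr_ae (ae_of_all _ fun p => ?_)
            simp only
            rw [integral_mul_const, integral_prod_mul (fun x => conj (F x) * e x p)
              (fun y => F y * conj (e y p))]
            congr 2
            simp only [hH]
            rw [← integral_conj]
            simp
        _ = ∫ z : X × X, ∫ p, (conj (F z.1) * e z.1 p) * (F z.2 * conj (e z.2 p)) * ω p
              ∂ρ ∂(μ.prod μ) := integral_integral_swap hwt
        _ = _ := by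
            refine integral_congr_ae (ae_of_all _ fun z => ?_)
            simp only
            rw [← integral_const_mul]
            congr 1
            ext p
            ring
    rw [e1, e2]
    refine (enorm_integral_le_lintegral_enorm _).trans ?_
    have hpt : ∀ z : X × X,
        ‖conj (F z.1) * F z.2 * ∫ p, e z.1 p * conj (e z.2 p) * ω p ∂ρ‖ₑ
          ≤ 2⁻¹ * (‖F z.1‖ₑ ^ 2 * κ z.1 z.2) + 2⁻¹ * (‖F z.2‖ₑ ^ 2 * κ z.2 z.1) := by
      intro z
      rw [enorm_mul, enorm_mul, hκs z.2 z.1, RCLike.enorm_conj]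
      calc ‖F z.1‖ₑ * ‖F z.2‖ₑ * _ ≤ (2⁻¹ * (‖F z.1‖ₑ ^ 2 + ‖F z.2‖ₑ ^ 2)) * κ z.1 z.2 := by
            refine mul_le_mul' ?_ (hK _ _)
            rw [← ofReal_norm, ← ofReal_norm, ← ENNReal.ofReal_mul (norm_nonneg _),
              ← ENNReal.ofReal_pow (norm_nonneg _), ← ENNReal.ofReal_pow (norm_nonneg _),
              ← ENNReal.ofReal_add (by positivity) (by positivity)]
            rw [show (2⁻¹ : ℝ≥0∞) = ENNReal.ofReal 2⁻¹ by
              rw [ENNReal.ofReal_inv_of_pos two_pos]; simp, ← ENNReal.ofReal_mul (by norm_num)]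
            refine ENNReal.ofReal_le_ofReal ?_
            nlinarith [sq_nonneg (‖F z.1‖ - ‖F z.2‖)]
        _ = _ := by ring
    refine (lintegral_mono hpt).trans ?_
    have hm1 : Measurable fun z : X × X => 2⁻¹ * (‖F z.1‖ₑ ^ 2 * κ z.1 z.2) :=
      (((hFm.comp measurable_fst).enorm.pow_const 2).mul hκm).const_mul _
    have hm2 : Measurable fun z : X × X => ‖F z.1‖ₑ ^ 2 * κ z.1 z.2 :=
      ((hFm.comp measurable_fst).enorm.pow_const 2).mul hκm
    rw [lintegral_add_left hm1, lintegral_const_mul _ hm2,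
      lintegral_const_mul' _ (fun z : X × X => ‖F z.2‖ₑ ^ 2 * κ z.2 z.1) (by simp)]
    have hsw : ∫⁻ z : X × X, ‖F z.2‖ₑ ^ 2 * κ z.2 z.1 ∂(μ.prod μ)
        = ∫⁻ z : X × X, ‖F z.1‖ₑ ^ 2 * κ z.1 z.2 ∂(μ.prod μ) :=
      lintegral_prod_swap (fun z : X × X => ‖F z.1‖ₑ ^ 2 * κ z.1 z.2)
    rw [hsw, ← add_mul, ENNReal.inv_two_add_inv_two, one_mul, lintegral_prod _ hm2.aemeasurable]
    calc ∫⁻ x, ∫⁻ y, ‖F x‖ₑ ^ 2 * κ x y ∂μ ∂μ ≤ ∫⁻ x, ‖F x‖ₑ ^ 2 * ENNReal.ofReal A ∂μ := by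
          refine lintegral_mono fun x => ?_
          rw [lintegral_const_mul' _ _ (by simp)]
          gcongr
          exact hκ x
      _ = ENNReal.ofReal A * Q := by
          rw [lintegral_mul_const' _ _ (by simp), mul_comm]
  have hQ3 : ∫⁻ p, ‖H p‖ₑ * ‖g p‖ₑ ∂ρ ≤ 2⁻¹ * (ENNReal.ofReal (A / m) * ∫⁻ p, ‖g p‖ₑ ^ 2 ∂ρ)
      + 2⁻¹ * (ENNReal.ofReal A⁻¹ * ∫⁻ p, ENNReal.ofReal (ω p) * ‖H p‖ₑ ^ 2 ∂ρ) := by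
    have hmg : Measurable fun p => ENNReal.ofReal (A / m) * ‖g p‖ₑ ^ 2 :=
      (hg.enorm.pow_const 2).const_mul _
    rw [← lintegral_const_mul' _ _ (by simp), ← lintegral_const_mul' _ _ (by simp),
      ← lintegral_const_mul' _ _ (by simp), ← lintegral_const_mul' _ _ (by simp),
      ← lintegral_add_left (hmg.const_mul _)]
    refine lintegral_mono_ae ?_
    filter_upwards [hgω] with p hp
    rw [show (2⁻¹ : ℝ≥0∞) = ENNReal.ofReal 2⁻¹ by
      rw [ENNReal.ofReal_inv_of_pos two_pos]; simp]
    have := hω0 p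
    rw [← ofReal_norm, ← ofReal_norm, ← ENNReal.ofReal_pow (norm_nonneg _),
      ← ENNReal.ofReal_pow (norm_nonneg _), ← ENNReal.ofReal_mul (norm_nonneg _),
      ← ENNReal.ofReal_mul (by positivity), ← ENNReal.ofReal_mul (by positivity),
      ← ENNReal.ofReal_mul (by positivity), ← ENNReal.ofReal_mul (by positivity),
      ← ENNReal.ofReal_mul (by positivity), ← ENNReal.ofReal_add (by positivity) (by positivity)]
    refine ENNReal.ofReal_le_ofReal ?_
    by_cases h0 : g p = 0
    · rw [h0]; simp only [norm_zero, mul_zero]; positivity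
    · have hmω := hp h0
      have h1 : A⁻¹ * (m * ‖H p‖ ^ 2) ≤ A⁻¹ * (ω p * ‖H p‖ ^ 2) := by gcongr
      have h2 : 0 ≤ (A / m) * (‖g p‖ - (m / A) * ‖H p‖) ^ 2 := by positivity
      have h3 : (A / m) * (‖g p‖ - (m / A) * ‖H p‖) ^ 2
          = A / m * ‖g p‖ ^ 2 + A⁻¹ * (m * ‖H p‖ ^ 2) - 2 * (‖H p‖ * ‖g p‖) := by
        field_simp; ring
      linarith
  have hfin : Q ≤ 2⁻¹ * (ENNReal.ofReal (A / m) * ∫⁻ p, ‖g p‖ₑ ^ 2 ∂ρ) + 2⁻¹ * Q := by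
    refine (hQ1.trans hQ3).trans ?_
    gcongr
    calc _ ≤ ENNReal.ofReal A⁻¹ * (ENNReal.ofReal A * Q) := by gcongr
      _ = Q := by
        rw [← mul_assoc, ← ENNReal.ofReal_mul (by positivity), inv_mul_cancel₀ hA.ne']; simp
  have h2 : 2⁻¹ * Q + 2⁻¹ * Q
      ≤ 2⁻¹ * (ENNReal.ofReal (A / m) * ∫⁻ p, ‖g p‖ₑ ^ 2 ∂ρ) + 2⁻¹ * Q := by
    rwa [← add_mul, ENNReal.inv_two_add_inv_two, one_mul]
  have h3 := ENNReal.le_of_add_le_add_right (ENNReal.mul_ne_top (by simp) hQfin) h2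
  exact (ENNReal.mul_le_mul_iff_right (by simp) (by simp)).1 h3

/-- The `T T*` inequality on a σ-finite measure space. -/
lemma lintegral_enorm_sq_le_of_kernel {X P : Type*} [MeasurableSpace X] [MeasurableSpace P]
    {μ : Measure X} [SigmaFinite μ] {ρ : Measure P} [SFinite ρ]
    {e : X → P → ℂ} (he : Measurable (Function.uncurry e)) (hb : ∀ x p, ‖e x p‖ ≤ 1)
    {κ : X → X → ℝ≥0∞} (hκm : Measurable (Function.uncurry κ)) (hκs : ∀ x y, κ x y = κ y x)
    {A : ℝ} (hA : 0 < A) (hκ : ∀ x, ∫⁻ y, κ x y ∂μ ≤ ENNReal.ofReal A)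
    {ω : P → ℝ} (hω0 : ∀ p, 0 ≤ ω p) (hωi : Integrable ω ρ)
    (hK : ∀ x y, ‖∫ p, e x p * conj (e y p) * ω p ∂ρ‖ₑ ≤ κ x y)
    {g : P → ℂ} (hg : Measurable g) (hgi : Integrable g ρ) {m : ℝ} (hm : 0 < m)
    (hgω : ∀ᵐ p ∂ρ, g p ≠ 0 → m ≤ ω p) :
    ∫⁻ x, ‖∫ p, e x p * g p ∂ρ‖ₑ ^ 2 ∂μ
      ≤ ENNReal.ofReal (A / m) * ∫⁻ p, ‖g p‖ₑ ^ 2 ∂ρ := by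
  rw [← setLIntegral_univ, ← iUnion_spanningSets μ,
    setLIntegral_iUnion_of_directed _ (monotone_spanningSets μ).directed_le]
  refine iSup_le fun i => ?_
  have : IsFiniteMeasure (μ.restrict (spanningSets μ i)) :=
    ⟨by simpa using measure_spanningSets_lt_top μ i⟩
  exact lintegral_enorm_sq_le_of_kernel_finite he hb hκm hκs hA
    (fun x => (setLIntegral_le_lintegral _ _).trans (hκ x)) hω0 hωi hK hg hgi hm hgω

lemma circleIntegral_sub_inv_of_one_lt_norm {r : ℂ} (hr : 1 < ‖r‖) :
    ∮ ζ in C(0, 1), (ζ - r)⁻¹ = 0 := by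
  refine DiffContOnCl.circleIntegral_eq_zero zero_le_one ?_
  have h0 : ∀ ζ ∈ Metric.closedBall (0 : ℂ) 1, ζ - r ≠ 0 := by
    intro ζ hζ h
    rw [sub_eq_zero] at h
    rw [mem_closedBall_zero_iff, h] at hζ
    linarith
  have : DifferentiableOn ℂ (fun ζ => (ζ - r)⁻¹) (Metric.closedBall (0 : ℂ) 1) :=
    (differentiableOn_id.sub_const r).inv h0
  exact this.diffContOnCl_ball subset_rfl

lemma mul_roots_of_sq_eq {z x w : ℂ} (hx : x ≠ 0) (hw : w ^ 2 = z ^ 2 + (‖x‖ : ℂ) ^ 2) :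
    (z + w) / (I * conj x) * ((z - w) / (I * conj x)) * conj x = x := by
  have hcx : conj x ≠ 0 := by simpa using hx
  have hI := Complex.I_ne_zero
  have hxx : conj x * x = (‖x‖ : ℂ) ^ 2 := Complex.conj_mul' x
  refine mul_right_cancel₀ hcx ?_
  rw [mul_comm x, hxx]
  field_simp
  rw [Complex.I_sq]
  linear_combination -hw

lemma integral_circle_inv_aux {z x w : ℂ} (hx : x ≠ 0) (hz : 0 < z.re)
    (hw : w ^ 2 = z ^ 2 + (‖x‖ : ℂ) ^ 2) (hw0 : w ≠ 0) (h1 : ‖(z + w) / (I * conj x)‖ < 1) :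
    ‖∫ θ in (0 : ℝ)..2 * Real.pi, (z - I * ((conj x * exp (θ * I)).re : ℂ))⁻¹‖ * ‖w‖
      = 2 * Real.pi := by
  have hcx : conj x ≠ 0 := by simpa using hx
  set r₁ := (z + w) / (I * conj x) with hr₁
  set r₂ := (z - w) / (I * conj x) with hr₂
  have hI := Complex.I_ne_zero
  have hsum : I * conj x * (r₁ + r₂) = 2 * z := by
    rw [hr₁, hr₂]; field_simp; ring
  have hprod : r₁ * r₂ * conj x = x := mul_roots_of_sq_eq hx hw
  have hnorm : ‖r₁‖ * ‖r₂‖ = 1 := by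
    have := congrArg norm hprod
    rw [norm_mul, norm_mul, RCLike.norm_conj] at this
    exact mul_right_cancel₀ (norm_ne_zero_iff.2 hx) (by rw [this, one_mul])
  have h2 : 1 < ‖r₂‖ := by
    by_contra h
    push Not at h
    have : ‖r₁‖ * ‖r₂‖ < 1 := mul_lt_one_of_nonneg_of_lt_one_left (norm_nonneg _) h1 h
    linarith
  have hwt : ∀ r : ℂ, ‖r‖ ≠ 1 → CircleIntegrable (fun ζ => (ζ - r)⁻¹) 0 1 := by
    intro r hr
    rw [circleIntegrable_sub_inv_iff]
    right
    simpa using hr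
  have hc : ∮ ζ in C(0, 1), (I / w) * ((ζ - r₁)⁻¹ - (ζ - r₂)⁻¹)
      = (I / w) * (2 * Real.pi * I) := by
    rw [circleIntegral.integral_const_mul,
      circleIntegral.integral_sub (hwt _ h1.ne) (hwt _ h2.ne'),
      circleIntegral_sub_inv_of_one_lt_norm h2,
      circleIntegral.integral_sub_inv_of_mem_ball (by simpa using h1), sub_zero]
  have he : ∫ θ in (0 : ℝ)..2 * Real.pi, (z - I * ((conj x * exp (θ * I)).re : ℂ))⁻¹
      = ∮ ζ in C(0, 1), (I / w) * ((ζ - r₁)⁻¹ - (ζ - r₂)⁻¹) := by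
    rw [circleIntegral]
    refine intervalIntegral.integral_congr fun θ _ => ?_
    simp only [deriv_circleMap, circleMap, ofReal_one, one_mul, zero_add, smul_eq_mul]
    set ζ := exp (θ * I) with hζ
    have hζ1 : ‖ζ‖ = 1 := Complex.norm_exp_ofReal_mul_I θ
    have hζ0 : ζ ≠ 0 := by rw [← norm_ne_zero_iff, hζ1]; norm_num
    have ha : ζ - r₁ ≠ 0 := fun h => by
      rw [sub_eq_zero] at h; rw [← h] at h1; linarith
    have hb : ζ - r₂ ≠ 0 := fun h => by
      rw [sub_eq_zero] at h; rw [← h] at h2; linarith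
    have hre : ((conj x * ζ).re : ℂ) = (conj x * ζ + x * conj ζ) / 2 := by
      rw [Complex.re_eq_add_conj]; simp
    have hcζ : conj ζ * ζ = 1 := by rw [Complex.conj_mul', hζ1]; simp
    have key : (z - I * ((conj x * ζ).re : ℂ)) * ζ * (2 * I) = conj x * (ζ - r₁) * (ζ - r₂) := by
      rw [hre]
      linear_combination (-I * ζ) * hsum - hprod + x * hcζ
        + (- x * ζ * conj ζ - ζ ^ 2 * conj x + ζ * (r₁ + r₂) * conj x) * I_sq
    have hd : r₁ - r₂ = 2 * w / (I * conj x) := by rw [hr₁, hr₂]; ring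
    have hne : z - I * ((conj x * ζ).re : ℂ) ≠ 0 := fun h => by
      have := congrArg Complex.re h
      simp at this
      linarith
    have hd' : (ζ - r₂) - (ζ - r₁) = 2 * w / (I * conj x) := by rw [← hd]; ring
    have hp : (ζ - r₁) * (ζ - r₂) = (z - I * ((conj x * ζ).re : ℂ)) * ζ * (2 * I) / conj x := by
      rw [key]; field_simp
    rw [inv_sub_inv ha hb, hd', hp]
    field_simp
  rw [he, hc, ← norm_mul]
  rw [show I / w * (2 * Real.pi * I) * w = -(2 * Real.pi : ℝ) by
    field_simp; rw [I_sq]; push_cast; ring]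
  rw [norm_neg, Complex.norm_real, Real.norm_of_nonneg (by positivity)]

lemma integral_circle_inv {z x : ℂ} (hz : 0 < z.re) :
    ‖∫ θ in (0 : ℝ)..2 * Real.pi, (z - I * ((conj x * exp (θ * I)).re : ℂ))⁻¹‖ ^ 2
      * ‖z ^ 2 + (‖x‖ : ℂ) ^ 2‖ = (2 * Real.pi) ^ 2 := by
  have hz0 : z ≠ 0 := fun h => by simp [h] at hz
  by_cases hx : x = 0
  · subst hx
    simp only [map_zero, zero_mul, zero_re, ofReal_zero, mul_zero, sub_zero,
      intervalIntegral.integral_const, norm_zero]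
    simp only [ne_eq, OfNat.ofNat_ne_zero, not_false_eq_true, zero_pow, add_zero, norm_smul,
      norm_inv, norm_pow, Real.norm_of_nonneg (show (0 : ℝ) ≤ 2 * Real.pi by positivity)]
    have := norm_ne_zero_iff.2 hz0
    field_simp
  · obtain ⟨w, hw⟩ := IsAlgClosed.exists_pow_nat_eq (z ^ 2 + (‖x‖ : ℂ) ^ 2) zero_lt_two
    have hw0 : w ≠ 0 := by
      rintro rfl
      have h : (z - I * ‖x‖) * (z + I * ‖x‖) = 0 := by
        linear_combination -hw - (‖x‖ : ℂ) ^ 2 * I_sq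
      rcases mul_eq_zero.1 h with h | h <;>
      · have := congrArg Complex.re h
        simp at this
        linarith
    have hcx : conj x ≠ 0 := by simpa using hx
    have hI := Complex.I_ne_zero
    have hprod := mul_roots_of_sq_eq hx hw
    have hne : ‖(z + w) / (I * conj x)‖ ≠ 1 := by
      intro h
      set r := (z + w) / (I * conj x) with hr
      have hcr : r * conj r = 1 := by rw [Complex.mul_conj', h]; simp
      have hr0 : r ≠ 0 := by rw [← norm_ne_zero_iff, h]; norm_num
      have h2 : (z - w) / (I * conj x) * conj x = x * conj r := by
        refine mul_left_cancel₀ hr0 ?_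
        linear_combination hprod - x * hcr
      have h3 : z - w = I * (x * conj r) := by
        rw [← h2]; field_simp
      have h4 : z + w = I * (conj x * r) := by
        rw [hr]; field_simp
      have h5 : z = I * ((conj x * r).re : ℂ) := by
        rw [Complex.re_eq_add_conj, map_mul, Complex.conj_conj]
        linear_combination (h3 + h4) / 2
      have := congrArg Complex.re h5
      simp at this
      simp [this] at hz
    have hnorm : ‖(z + w) / (I * conj x)‖ * ‖(z - w) / (I * conj x)‖ = 1 := by
      have := congrArg norm hprod
      rw [norm_mul, norm_mul, RCLike.norm_conj] at this
      exact mul_right_cancel₀ (norm_ne_zero_iff.2 hx) (by rw [this, one_mul])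
    rw [← hw, norm_pow, ← mul_pow]
    congr 1
    rcases lt_or_gt_of_ne hne with h | h
    · exact integral_circle_inv_aux hx hz hw hw0 h
    · have := integral_circle_inv_aux (w := -w) hx hz (by rw [← hw]; ring) (neg_ne_zero.2 hw0) (by
        rw [← sub_eq_add_neg]
        by_contra h'
        push Not at h'
        nlinarith)
      rwa [norm_neg] at this

lemma integrable_exp_neg_mul_norm_div_norm {ε : ℝ} (hε : 0 < ε) :
    Integrable fun ξ : E2 => Real.exp (-ε * ‖ξ‖) / ‖ξ‖ := by
  have hmp := Complex.orthonormalBasisOneI.repr.measurePreserving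
  rw [← hmp.integrable_comp_emb
    Complex.orthonormalBasisOneI.repr.toHomeomorph.measurableEmbedding]
  refine ⟨Measurable.aestronglyMeasurable (by fun_prop), ?_⟩
  rw [HasFiniteIntegral, ← Complex.lintegral_comp_polarCoord_symm]
  have h1 : IntegrableOn (fun r : ℝ => Real.exp (-ε * r)) (Set.Ioi 0) :=
    integrableOn_exp_mul_Ioi (by linarith) 0
  have h2 : Integrable (fun p : ℝ × ℝ => Real.exp (-ε * p.1))
      ((volume.restrict (Set.Ioi 0)).prod (volume.restrict (Set.Ioo (-Real.pi) Real.pi))) :=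
    Integrable.comp_fst h1 _
  rw [Measure.prod_restrict, ← Measure.volume_eq_prod] at h2
  refine lt_of_le_of_lt (setLIntegral_mono' polarCoord.open_target.measurableSet
    fun p hp => ?_) h2.2
  have hp1 : 0 < p.1 := by
    simp only [polarCoord_target, Set.mem_prod, Set.mem_Ioi] at hp
    exact hp.1
  simp only [Function.comp_apply, LinearIsometryEquiv.norm_map, Complex.norm_polarCoord_symm,
    abs_of_pos hp1, smul_eq_mul]
  rw [← ofReal_norm, ← ofReal_norm, ← ENNReal.ofReal_mul hp1.le]
  refine ENNReal.ofReal_le_ofReal (le_of_eq ?_)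
  rw [norm_div, Real.norm_of_nonneg hp1.le]
  field_simp

lemma integral_cone_kernel_eq {ε : ℝ} (hε : 0 < ε) (t : ℝ) (x : E2) :
    ∫ ξ : E2, exp (I * ((⟪x, ξ⟫ + t * ‖ξ‖ : ℝ) : ℂ)) * (Real.exp (-ε * ‖ξ‖) / ‖ξ‖ : ℝ)
      = ∫ θ in (0 : ℝ)..2 * Real.pi, ((ε - I * t : ℂ) -
          I * ((conj (Complex.orthonormalBasisOneI.repr.symm x) * exp (θ * I)).re : ℂ))⁻¹ := by
  have hmp := Complex.orthonormalBasisOneI.repr.measurePreserving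
  set x' := Complex.orthonormalBasisOneI.repr.symm x with hx'
  have hin : ∀ w : ℂ, ⟪x, Complex.orthonormalBasisOneI.repr w⟫ = (conj x' * w).re := fun w => by
    rw [← Complex.orthonormalBasisOneI.repr.apply_symm_apply x,
      LinearIsometryEquiv.inner_map_map, Complex.inner, mul_comm]
  set z : ℝ → ℂ := fun θ => (ε - I * t : ℂ) - I * ((conj x' * exp (θ * I)).re : ℂ) with hz
  have hzc : Continuous z := by rw [hz]; fun_prop
  have hzre : ∀ θ, (z θ).re = ε := fun θ => by simp [hz]
  rw [← hmp.integral_comp Complex.orthonormalBasisOneI.repr.toHomeomorph.measurableEmbedding,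
    ← Complex.integral_comp_polarCoord_symm]
  calc _ = ∫ p in Set.Ioi (0 : ℝ) ×ˢ Set.Ioo (-Real.pi) Real.pi, exp (-z p.2 * p.1) := by
        refine setIntegral_congr_fun polarCoord.open_target.measurableSet fun p hp => ?_
        have hp1 : 0 < p.1 := by
          simp only [polarCoord_target, Set.mem_prod, Set.mem_Ioi] at hp
          exact hp.1
        have hpc : Complex.polarCoord.symm p = p.1 * exp (p.2 * I) := by
          rw [Complex.polarCoord_symm_apply, Complex.exp_mul_I]; push_cast; rfl
        have hnp : ‖(p.1 : ℂ) * exp (p.2 * I)‖ = p.1 := by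
          rw [norm_mul, Complex.norm_exp_ofReal_mul_I, Complex.norm_real, mul_one,
            Real.norm_of_nonneg hp1.le]
        simp only [LinearIsometryEquiv.norm_map, hin, real_smul, hpc, hnp]
        have : (conj x' * (p.1 * exp (p.2 * I))).re = p.1 * (conj x' * exp (p.2 * I)).re := by
          rw [mul_left_comm, Complex.re_ofReal_mul]
        rw [this]
        push_cast
        have hp0 : (p.1 : ℂ) ≠ 0 := by exact_mod_cast hp1.ne'
        rw [mul_div_assoc', mul_div_cancel₀ _ hp0, ← Complex.exp_add]
        congr 1
        simp only [hz]
        ring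
    _ = ∫ θ in Set.Ioo (-Real.pi) Real.pi, ∫ r in Set.Ioi (0 : ℝ), exp (-z θ * r) := by
        rw [Measure.volume_eq_prod, ← Measure.prod_restrict, integral_prod_symm]
        have h1 : IntegrableOn (fun r : ℝ => Real.exp (-ε * r)) (Set.Ioi 0) :=
          integrableOn_exp_mul_Ioi (by linarith) 0
        have h2 : Integrable (fun p : ℝ × ℝ => Real.exp (-ε * p.1))
            ((volume.restrict (Set.Ioi 0)).prod (volume.restrict (Set.Ioo (-Real.pi) Real.pi))) :=
          Integrable.comp_fst h1 _
        refine h2.mono' (Continuous.aestronglyMeasurable (by fun_prop))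
          (ae_of_all _ fun p => ?_)
        rw [Complex.norm_exp, Complex.re_mul_ofReal, Complex.neg_re, hzre]
    _ = ∫ θ in Set.Ioo (-Real.pi) Real.pi, (z θ)⁻¹ := by
        refine setIntegral_congr_fun measurableSet_Ioo fun θ _ => ?_
        rw [integral_exp_mul_complex_Ioi (by rw [Complex.neg_re, hzre]; linarith)]
        simp
    _ = ∫ θ in (-Real.pi)..Real.pi, (z θ)⁻¹ := by
        rw [intervalIntegral.integral_of_le (by linarith [Real.pi_pos]),
          integral_Ioc_eq_integral_Ioo]
    _ = _ := by
        have hper : Function.Periodic (fun θ => (z θ)⁻¹) (2 * Real.pi) := fun θ => by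
          have : exp (((θ + 2 * Real.pi : ℝ) : ℂ) * I) = exp (θ * I) := by
            push_cast; rw [add_mul, Complex.exp_periodic]
          simp only [hz, this]
        have := hper.intervalIntegral_add_eq (-Real.pi) 0
        rw [zero_add] at this
        rw [← this]
        congr 1
        ring

/-- The frequency-localised dispersive estimate for the wave equation in two dimensions. -/
lemma norm_integral_cone_kernel_sq_mul_le {ε : ℝ} (hε : 0 < ε) (t : ℝ) (x : E2) :
    ‖∫ ξ : E2, exp (I * ((⟪x, ξ⟫ + t * ‖ξ‖ : ℝ) : ℂ)) * (Real.exp (-ε * ‖ξ‖) / ‖ξ‖ : ℝ)‖ ^ 2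
      * (2 * ε * |t|) ≤ (2 * Real.pi) ^ 2 := by
  rw [integral_cone_kernel_eq hε,
    ← integral_circle_inv (z := (ε - I * t : ℂ))
      (x := Complex.orthonormalBasisOneI.repr.symm x) (by simpa using hε)]
  gcongr
  refine le_trans (le_of_eq ?_) (Complex.abs_im_le_norm _)
  have : (((ε : ℂ) - I * t) ^ 2 + (‖Complex.orthonormalBasisOneI.repr.symm x‖ : ℂ) ^ 2).im
      = -(2 * ε * t) := by
    simp [sq]; ring
  rw [this, abs_neg, abs_mul, abs_of_pos (by positivity : 0 < 2 * ε)]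

lemma integral_gaussian_kernel {δ : ℝ} (hδ : 0 < δ) (x : E2) :
    ∫ ξ : E2, exp (I * (⟪x, ξ⟫ : ℝ)) * (Real.exp (-δ * ‖ξ‖ ^ 2) : ℝ)
      = (Real.pi / δ * Real.exp (-(4 * δ)⁻¹ * ‖x‖ ^ 2) : ℝ) := by
  have h := GaussianFourier.integral_cexp_neg_mul_sq_norm_add (b := (δ : ℂ)) (by simpa using hδ) I x
  convert h using 1
  · refine integral_congr_ae (ae_of_all _ fun ξ => ?_)
    simp only [ofReal_exp, ← Complex.exp_add]
    congr 1
    push_cast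
    ring
  · simp
    left
    congr 1
    field_simp

lemma integrable_gaussian {δ : ℝ} (hδ : 0 < δ) :
    Integrable fun ξ : E2 => Real.exp (-δ * ‖ξ‖ ^ 2) := by
  by_contra h
  have h1 := integral_undef h
  have h2 := GaussianFourier.integral_rexp_neg_mul_sq_norm (V := E2) hδ
  rw [h1] at h2
  simp at h2
  have := Real.pi_pos
  exact absurd h2 (by positivity)

lemma integral_gaussian_E2 {δ : ℝ} (hδ : 0 < δ) :
    ∫ ξ : E2, Real.exp (-δ * ‖ξ‖ ^ 2) = Real.pi / δ := by
  have h2 := GaussianFourier.integral_rexp_neg_mul_sq_norm (V := E2) hδ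
  simpa using h2

/-- The plane wave with modulation `q.1` and spatial frequency `q.2`. -/
def planeWave (s t : ℝ) (x : E2) (q : ℝ × E2) : ℂ :=
  exp (I * ((t * (q.1 - s * ‖q.2‖) + ⟪x, q.2⟫ : ℝ) : ℂ))

lemma norm_planeWave (s t : ℝ) (x : E2) (q : ℝ × E2) : ‖planeWave s t x q‖ = 1 := by
  rw [planeWave, mul_comm, Complex.norm_exp_ofReal_mul_I]

@[fun_prop]
lemma continuous_planeWave (s : ℝ) :
    Continuous fun p : (ℝ × E2) × (ℝ × E2) => planeWave s p.1.1 p.1.2 p.2 := by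
  unfold planeWave; fun_prop

lemma planeWave_mul_conj (s t t' : ℝ) (x x' : E2) (q : ℝ × E2) :
    planeWave s t x q * conj (planeWave s t' x' q)
      = exp (I * ((t - t') * q.1 : ℝ))
        * exp (I * ((⟪x - x', q.2⟫ + (-s * (t - t')) * ‖q.2‖ : ℝ) : ℂ)) := by
  simp only [planeWave, ← Complex.exp_conj, ← Complex.exp_add, map_mul, conj_I, conj_ofReal]
  congr 1
  rw [inner_sub_left]
  push_cast
  ring

lemma integral_gaussian_kernel_real {L : ℝ} (hL : 0 < L) (t : ℝ) :
    ∫ l : ℝ, exp (I * (t * l : ℝ)) * (Real.exp (-(4 * L ^ 2)⁻¹ * l ^ 2) : ℝ)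
      = (2 * L * Real.sqrt Real.pi * Real.exp (-L ^ 2 * t ^ 2) : ℝ) := by
  have hb : (0 : ℝ) < (4 * L ^ 2)⁻¹ := by positivity
  have h := GaussianFourier.integral_cexp_neg_mul_sq_norm_add (b := ((4 * L ^ 2)⁻¹ : ℝ))
    (by rw [ofReal_re]; exact hb) I t
  have e1 : ((Real.pi : ℂ) / ((4 * L ^ 2)⁻¹ : ℝ)) ^ ((Module.finrank ℝ ℝ : ℂ) / 2)
      = (2 * L * Real.sqrt Real.pi : ℝ) := by
    rw [← ofReal_div, Module.finrank_self]
    have : ((1 : ℕ) : ℂ) / 2 = ((1 / 2 : ℝ) : ℂ) := by push_cast; ring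
    rw [this, ← ofReal_cpow (by positivity), ← Real.sqrt_eq_rpow]
    congr 1
    rw [show Real.pi / (4 * L ^ 2)⁻¹ = (2 * L) ^ 2 * Real.pi by field_simp; norm_num,
      Real.sqrt_mul (by positivity), Real.sqrt_sq (by positivity)]
  rw [e1] at h
  convert h using 1
  · refine integral_congr_ae (ae_of_all _ fun ξ => ?_)
    simp only [ofReal_exp, ← Complex.exp_add]
    congr 1
    rw [Real.norm_eq_abs, ← ofReal_pow |ξ|, sq_abs]
    simp
    ring
  · rw [ofReal_mul]
    congr 1
    rw [ofReal_exp]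
    congr 1
    rw [Real.norm_eq_abs, ← ofReal_pow |t|, sq_abs]
    simp
    field_simp

lemma integrable_gaussian_real {L : ℝ} (hL : 0 < L) :
    Integrable fun l : ℝ => Real.exp (-(4 * L ^ 2)⁻¹ * l ^ 2) :=
  integrable_exp_neg_mul_sq (by positivity)

/-- Fixed-time `L²` bound for a function localised in modulation and frequency. -/
lemma lintegral_space_planeWave_le (s t : ℝ) {L δ : ℝ} (hL : 0 < L) (hδ : 0 < δ)
    {g : ℝ × E2 → ℂ} (hg : Measurable g) (hgi : Integrable g)
    (hsupp : ∀ q, g q ≠ 0 → |q.1| ≤ 2 * L ∧ δ * ‖q.2‖ ^ 2 ≤ 1) :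
    ∫⁻ x : E2, ‖∫ q, planeWave s t x q * g q‖ₑ ^ 2
      ≤ ENNReal.ofReal (8 * Real.sqrt Real.pi * Real.pi ^ 2 * Real.exp 2 * L)
        * ∫⁻ q, ‖g q‖ₑ ^ 2 := by
  have hsp : 0 < Real.sqrt Real.pi := Real.sqrt_pos.2 Real.pi_pos
  have hpi := Real.pi_pos
  have key := lintegral_enorm_sq_le_of_kernel (μ := (volume : Measure E2))
    (ρ := (volume : Measure (ℝ × E2))) (e := fun x q => planeWave s t x q)
    (κ := fun x y => ENNReal.ofReal (2 * L * Real.sqrt Real.pi *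
      (Real.pi / δ * Real.exp (-(4 * δ)⁻¹ * ‖x - y‖ ^ 2))))
    (A := 8 * Real.sqrt Real.pi * Real.pi ^ 2 * L)
    (ω := fun q => Real.exp (-(4 * L ^ 2)⁻¹ * q.1 ^ 2) * Real.exp (-δ * ‖q.2‖ ^ 2))
    (m := Real.exp (-2)) (g := g)
    (by
      unfold Function.uncurry
      exact ((continuous_planeWave s).comp (by fun_prop :
        Continuous fun a : E2 × (ℝ × E2) => ((t, a.1), a.2))).measurable)
    (fun x q => (norm_planeWave s t x q).le)
    (by unfold Function.uncurry; fun_prop)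
    (fun x y => by rw [norm_sub_rev]) (by positivity)
    (fun x => by
      have h1 := lintegral_sub_left_eq_self (μ := (volume : Measure E2))
        (fun y : E2 => ENNReal.ofReal (2 * L * Real.sqrt Real.pi *
          (Real.pi / δ * Real.exp (-(4 * δ)⁻¹ * ‖y‖ ^ 2)))) x
      rw [h1, ← ofReal_integral_eq_lintegral_ofReal]
      · rw [integral_const_mul, integral_const_mul, integral_gaussian_E2 (by positivity)]
        refine ENNReal.ofReal_le_ofReal (le_of_eq ?_)
        field_simp
        norm_num
      · exact ((integrable_gaussian (by positivity)).const_mul _).const_mul _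
      · exact ae_of_all _ fun y => by positivity)
    (fun q => by positivity)
    ((integrable_gaussian_real hL).mul_prod (integrable_gaussian hδ))
    (fun x y => by
      have : ∀ q : ℝ × E2, planeWave s t x q * conj (planeWave s t y q)
          * ((Real.exp (-(4 * L ^ 2)⁻¹ * q.1 ^ 2) * Real.exp (-δ * ‖q.2‖ ^ 2) : ℝ) : ℂ)
          = (exp (I * (0 * q.1 : ℝ)) * (Real.exp (-(4 * L ^ 2)⁻¹ * q.1 ^ 2) : ℝ))
            * (exp (I * (⟪x - y, q.2⟫ : ℝ)) * (Real.exp (-δ * ‖q.2‖ ^ 2) : ℝ)) := fun q => by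
        rw [planeWave_mul_conj]
        simp only [sub_self, mul_zero, zero_mul, add_zero]
        push_cast
        ring
      simp_rw [this]
      rw [Measure.volume_eq_prod,
        integral_prod_mul (fun l : ℝ => exp (I * (0 * l : ℝ))
          * (Real.exp (-(4 * L ^ 2)⁻¹ * l ^ 2) : ℝ))
          (fun ξ : E2 => exp (I * (⟪x - y, ξ⟫ : ℝ)) * (Real.exp (-δ * ‖ξ‖ ^ 2) : ℝ)),
        integral_gaussian_kernel_real hL, integral_gaussian_kernel hδ, ← ofReal_mul,
        ← ofReal_norm, Complex.norm_real, Real.norm_of_nonneg (by positivity)]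
      simp)
    hg hgi (Real.exp_pos _)
    (ae_of_all _ fun q hq => by
      obtain ⟨h1, h2⟩ := hsupp q hq
      rw [← Real.exp_add]
      refine Real.exp_le_exp.2 ?_
      have h3 : q.1 ^ 2 ≤ (2 * L) ^ 2 := sq_le_sq' (by linarith [(abs_le.1 h1).1]) (abs_le.1 h1).2
      have : (4 * L ^ 2)⁻¹ * q.1 ^ 2 ≤ 1 := by
        rw [inv_mul_le_iff₀ (by positivity)]; linarith
      linarith)
  refine key.trans (le_of_eq ?_)
  congr 2
  rw [Real.exp_neg]
  field_simp

lemma integral_abs_rpow_mul_exp {b : ℝ} (hb : 0 < b) :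
    ∫ u : ℝ, |u| ^ (-1 / 2 : ℝ) * Real.exp (-b * |u| ^ (2 : ℝ))
      = b ^ (-1 / 4 : ℝ) * Real.Gamma (1 / 4) := by
  have h := integral_comp_abs (f := fun u => u ^ (-1 / 2 : ℝ) * Real.exp (-b * u ^ (2 : ℝ)))
  rw [h, _root_.integral_rpow_mul_exp_neg_mul_rpow (by norm_num) (by norm_num) hb]
  norm_num
  ring

lemma integrable_abs_rpow_mul_exp {b : ℝ} (hb : 0 < b) :
    Integrable fun u : ℝ => |u| ^ (-1 / 2 : ℝ) * Real.exp (-b * |u| ^ (2 : ℝ)) := by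
  by_contra h
  have h1 := integral_undef h
  rw [integral_abs_rpow_mul_exp hb] at h1
  have h2 : 0 < Real.Gamma (1 / 4) := Real.Gamma_pos_of_pos (by norm_num)
  have h3 : 0 < b ^ (-1 / 4 : ℝ) := by positivity
  exact absurd h1 (by positivity)

lemma norm_cone_kernel_le {ε : ℝ} (hε : 0 < ε) {t : ℝ} (ht : t ≠ 0) (x : E2) :
    ‖∫ ξ : E2, exp (I * ((⟪x, ξ⟫ + t * ‖ξ‖ : ℝ) : ℂ)) * (Real.exp (-ε * ‖ξ‖) / ‖ξ‖ : ℝ)‖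
      ≤ 2 * Real.pi / Real.sqrt ε * |t| ^ (-1 / 2 : ℝ) := by
  have h := norm_integral_cone_kernel_sq_mul_le hε t x
  set K := ‖∫ ξ : E2, exp (I * ((⟪x, ξ⟫ + t * ‖ξ‖ : ℝ) : ℂ))
    * (Real.exp (-ε * ‖ξ‖) / ‖ξ‖ : ℝ)‖
  have ht' : 0 < |t| := abs_pos.2 ht
  have hpi := Real.pi_pos
  rw [show (-1 / 2 : ℝ) = -(1 / 2) by norm_num, Real.rpow_neg ht'.le, ← Real.sqrt_eq_rpow]
  have e1 : (2 * Real.pi / Real.sqrt ε * (Real.sqrt |t|)⁻¹) =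
      2 * Real.pi / Real.sqrt (ε * |t|) := by
    rw [Real.sqrt_mul hε.le]; field_simp
  rw [e1, le_div_iff₀ (by positivity)]
  refine (abs_le_of_sq_le_sq' ?_ (by positivity)).2
  rw [mul_pow, Real.sq_sqrt (by positivity)]
  refine le_trans ?_ h
  have : 0 ≤ K ^ 2 * (ε * |t|) := by positivity
  linarith

/-- `L²` bound in time along an arbitrary measurable trajectory. -/
lemma lintegral_time_planeWave_le {s : ℝ} (hs : |s| = 1) {X : ℝ → E2} (hX : Measurable X)
    {L ε : ℝ} (hL : 0 < L) (hε : 0 < ε)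
    {g : ℝ × E2 → ℂ} (hg : Measurable g) (hgi : Integrable g)
    (hsupp : ∀ q, g q ≠ 0 → |q.1| ≤ 2 * L ∧ ε * ‖q.2‖ ≤ 1) :
    ∫⁻ t : ℝ, ‖∫ q, planeWave s t (X t) q * g q‖ₑ ^ 2
      ≤ ENNReal.ofReal (4 * Real.sqrt Real.pi * Real.pi * Real.Gamma (1 / 4) * Real.exp 2
          * (Real.sqrt L / (ε * Real.sqrt ε)))
        * ∫⁻ q, ‖g q‖ₑ ^ 2 := by
  have hsp : 0 < Real.sqrt Real.pi := Real.sqrt_pos.2 Real.pi_pos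
  have hsε : 0 < Real.sqrt ε := Real.sqrt_pos.2 hε
  have hsL : 0 < Real.sqrt L := Real.sqrt_pos.2 hL
  have hG : 0 < Real.Gamma (1 / 4) := Real.Gamma_pos_of_pos (by norm_num)
  have hpi := Real.pi_pos
  set κ₀ : ℝ → ℝ := fun u => 4 * L * Real.sqrt Real.pi * Real.pi / Real.sqrt ε *
    (|u| ^ (-1 / 2 : ℝ) * Real.exp (-L ^ 2 * |u| ^ (2 : ℝ))) with hκ₀
  have hκ₀m : Measurable κ₀ := by fun_prop
  have hms : MeasurableSet {p : ℝ × ℝ | p.1 = p.2} :=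
    measurableSet_eq_fun measurable_fst measurable_snd
  have key := lintegral_enorm_sq_le_of_kernel (μ := (volume : Measure ℝ))
    (ρ := (volume : Measure (ℝ × E2))) (e := fun t q => planeWave s t (X t) q)
    (κ := fun t t' => if t = t' then ⊤ else ENNReal.ofReal (κ₀ (t - t')))
    (A := 4 * Real.sqrt Real.pi * Real.pi * Real.Gamma (1 / 4) * (Real.sqrt L / Real.sqrt ε))
    (ω := fun q => Real.exp (-(4 * L ^ 2)⁻¹ * q.1 ^ 2) * (Real.exp (-ε * ‖q.2‖) / ‖q.2‖))
    (m := Real.exp (-2) * ε) (g := g)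
    (by
      unfold Function.uncurry
      exact (continuous_planeWave s).measurable.comp (by fun_prop :
        Measurable fun a : ℝ × (ℝ × E2) => ((a.1, X a.1), a.2)))
    (fun x q => (norm_planeWave s _ _ q).le)
    (by
      unfold Function.uncurry
      exact Measurable.ite hms measurable_const (by fun_prop))
    (fun x y => by
      simp only [eq_comm (a := x), hκ₀, abs_sub_comm x y]) (by positivity)
    (fun t => by
      have h0 : (fun t' => if t = t' then ⊤ else ENNReal.ofReal (κ₀ (t - t')))
          =ᵐ[volume] fun t' => ENNReal.ofReal (κ₀ (t - t')) := by
        have : ∀ᵐ t' : ℝ, t' ≠ t := by simp [ae_iff]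
        filter_upwards [this] with t' ht'
        rw [if_neg (Ne.symm ht')]
      rw [lintegral_congr_ae h0]
      have h1 := lintegral_sub_left_eq_self (μ := (volume : Measure ℝ))
        (fun u => ENNReal.ofReal (κ₀ u)) t
      rw [h1, ← ofReal_integral_eq_lintegral_ofReal]
      · rw [hκ₀, integral_const_mul, integral_abs_rpow_mul_exp (by positivity)]
        refine ENNReal.ofReal_le_ofReal (le_of_eq ?_)
        have : L * (L ^ 2) ^ (-1 / 4 : ℝ) = Real.sqrt L := by
          rw [← Real.rpow_natCast L 2, ← Real.rpow_mul hL.le, Real.sqrt_eq_rpow]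
          nth_rewrite 1 [← Real.rpow_one L]
          rw [← Real.rpow_add hL]
          norm_num
        rw [← this]
        ring
      · exact (integrable_abs_rpow_mul_exp (by positivity)).const_mul _
      · exact ae_of_all _ fun y => by simp only [Pi.zero_apply, hκ₀]; positivity)
    (fun q => by positivity)
    ((integrable_gaussian_real hL).mul_prod (integrable_exp_neg_mul_norm_div_norm hε))
    (fun t t' => by
      by_cases htt : t = t'
      · rw [if_pos htt]; exact le_top
      rw [if_neg htt]
      have : ∀ q : ℝ × E2, planeWave s t (X t) q * conj (planeWave s t' (X t') q)
          * ((Real.exp (-(4 * L ^ 2)⁻¹ * q.1 ^ 2) * (Real.exp (-ε * ‖q.2‖) / ‖q.2‖) : ℝ) : ℂ)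
          = (exp (I * ((t - t') * q.1 : ℝ)) * (Real.exp (-(4 * L ^ 2)⁻¹ * q.1 ^ 2) : ℝ))
            * (exp (I * ((⟪X t - X t', q.2⟫ + (-s * (t - t')) * ‖q.2‖ : ℝ) : ℂ))
              * (Real.exp (-ε * ‖q.2‖) / ‖q.2‖ : ℝ)) := fun q => by
        rw [planeWave_mul_conj, ofReal_mul (Real.exp _)]
        ring
      simp_rw [this]
      rw [Measure.volume_eq_prod,
        integral_prod_mul (fun l : ℝ => exp (I * ((t - t') * l : ℝ))
          * (Real.exp (-(4 * L ^ 2)⁻¹ * l ^ 2) : ℝ))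
          (fun ξ : E2 => exp (I * ((⟪X t - X t', ξ⟫ + (-s * (t - t')) * ‖ξ‖ : ℝ) : ℂ))
            * (Real.exp (-ε * ‖ξ‖) / ‖ξ‖ : ℝ)),
        integral_gaussian_kernel_real hL, ← ofReal_norm, norm_mul, Complex.norm_real,
        Real.norm_of_nonneg (by positivity)]
      refine ENNReal.ofReal_le_ofReal ?_
      have hs0 : s ≠ 0 := fun h => by simp [h] at hs
      have h1 := norm_cone_kernel_le hε
        (t := -s * (t - t')) (mul_ne_zero (neg_ne_zero.2 hs0) (sub_ne_zero.2 htt)) (X t - X t')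
      rw [abs_mul, abs_neg, hs, one_mul] at h1
      refine (mul_le_mul_of_nonneg_left h1 (by positivity)).trans (le_of_eq ?_)
      rw [hκ₀]
      simp only [Real.rpow_two, sq_abs]
      ring)
    hg hgi (by positivity)
    (by
      have h0 : ∀ᵐ q : ℝ × E2, q.2 ≠ 0 := by
        rw [Measure.volume_eq_prod]
        exact Measure.quasiMeasurePreserving_snd.ae (p := fun ξ : E2 => ξ ≠ 0)
          (by simp [ae_iff])
      filter_upwards [h0] with q hq0 hq
      obtain ⟨h1, h2⟩ := hsupp q hq
      have hn : 0 < ‖q.2‖ := norm_pos_iff.2 hq0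
      rw [← mul_div_assoc, ← Real.exp_add, le_div_iff₀ hn, mul_assoc]
      refine (mul_le_of_le_one_right (Real.exp_pos _).le h2).trans ?_
      refine Real.exp_le_exp.2 ?_
      have h3 : q.1 ^ 2 ≤ (2 * L) ^ 2 := sq_le_sq' (by linarith [(abs_le.1 h1).1]) (abs_le.1 h1).2
      have : (4 * L ^ 2)⁻¹ * q.1 ^ 2 ≤ 1 := by
        rw [inv_mul_le_iff₀ (by positivity)]; linarith
      linarith)
  refine key.trans (le_of_eq ?_)
  congr 2
  rw [Real.exp_neg]
  field_simp

lemma exists_measurable_maximizer {v : ℝ → E2 → ℝ≥0∞} (hv : Measurable (Function.uncurry v))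
    (x : ℕ → E2) (M : ℕ) :
    ∃ X : ℝ → E2, Measurable X ∧ ∀ t, ∀ i ≤ M, v t (x i) ≤ v t (X t) := by
  induction M with
  | zero =>
    exact ⟨fun _ => x 0, measurable_const, fun t i hi => by rw [Nat.le_zero.1 hi]⟩
  | succ M ih =>
    obtain ⟨X, hX, hmax⟩ := ih
    have h1 : Measurable fun t => v t (X t) := hv.comp (measurable_id.prodMk hX)
    have h2 : Measurable fun t => v t (x (M + 1)) := hv.comp (measurable_id.prodMk measurable_const)
    classical
    refine ⟨fun t => if v t (x (M + 1)) ≤ v t (X t) then X t else x (M + 1),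
      Measurable.ite (measurableSet_le h2 h1) hX measurable_const, fun t i hi => ?_⟩
    dsimp only
    rcases Nat.lt_or_ge M i with h | h
    · obtain rfl : i = M + 1 := by omega
      split_ifs with h3
      · exact h3
      · exact le_rfl
    · split_ifs with h3
      · exact hmax t i h
      · exact (hmax t i h).trans (not_le.1 h3).le

/-- A bound along all measurable trajectories yields a maximal function bound. -/
lemma exists_maximal_function {u : ℝ → E2 → ℂ} (hu : Measurable (Function.uncurry u))
    (hc : ∀ t, Continuous (u t)) {B : ℝ≥0∞}
    (hB : ∀ X : ℝ → E2, Measurable X → ∫⁻ t, ‖u t (X t)‖ₑ ^ 2 ≤ B) :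
    ∃ c : ℝ → ℝ≥0∞, Measurable c ∧ (∀ t x, ‖u t x‖ₑ ≤ c t) ∧ ∫⁻ t, c t ^ 2 ≤ B := by
  set x := TopologicalSpace.denseSeq E2
  have hum : ∀ i, Measurable fun t => ‖u t (x i)‖ₑ := fun i =>
    (hu.comp (measurable_id.prodMk measurable_const)).enorm
  refine ⟨fun t => ⨆ i, ‖u t (x i)‖ₑ, Measurable.iSup hum, fun t y => ?_, ?_⟩
  · have hcl : IsClosed {y : E2 | ‖u t y‖ₑ ≤ ⨆ i, ‖u t (x i)‖ₑ} :=
      isClosed_le (hc t).enorm continuous_const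
    have hd := (TopologicalSpace.denseRange_denseSeq E2)
    exact hcl.closure_subset_iff.2 (Set.range_subset_iff.2 fun i =>
      le_iSup (fun i => ‖u t (x i)‖ₑ) i)
      (hd y)
  · have h1 : ∀ t, (⨆ i, ‖u t (x i)‖ₑ) ^ 2
        = ⨆ M, (partialSups (fun i => ‖u t (x i)‖ₑ) M) ^ 2 := fun t => by
      rw [← iSup_partialSups_eq, ENNReal.iSup_pow]
    simp_rw [h1]
    have hpm : ∀ M, Measurable fun t => partialSups (fun i => ‖u t (x i)‖ₑ) M := fun M => by
      simp_rw [partialSups_eq_biSup]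
      exact Measurable.iSup fun i => Measurable.iSup fun _ => hum i
    rw [lintegral_iSup (fun M => (hpm M).pow_const 2)
      (fun M N hMN t => by
        gcongr)]
    refine iSup_le fun M => ?_
    obtain ⟨X, hX, hmax⟩ := exists_measurable_maximizer (v := fun t x => ‖u t x‖ₑ)
      (by exact hu.enorm) x M
    refine le_trans (lintegral_mono fun t => ?_) (hB X hX)
    gcongr
    exact partialSups_le _ _ _ fun i hi => hmax t i hi

/-- Minkowski's inequality for finite sums of nonnegative functions. -/
lemma lintegral_Lp_sum_le {X ι : Type*} [MeasurableSpace X] {μ : Measure X} {p : ℝ} (hp : 1 ≤ p)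
    (s : Finset ι) {F : ι → X → ℝ≥0∞} (hF : ∀ i, Measurable (F i)) :
    (∫⁻ x, (∑ i ∈ s, F i x) ^ p ∂μ) ^ (1 / p) ≤ ∑ i ∈ s, (∫⁻ x, F i x ^ p ∂μ) ^ (1 / p) := by
  classical
  have hp0 : 0 < p := by linarith
  induction s using Finset.induction_on with
  | empty => simp [ENNReal.zero_rpow_of_pos hp0, hp0]
  | insert a s ha ih =>
    simp_rw [Finset.sum_insert ha]
    refine (ENNReal.lintegral_Lp_add_le (f := F a) (g := fun x => ∑ i ∈ s, F i x)
      (hF a).aemeasurable (Finset.measurable_fun_sum s fun i _ => hF i).aemeasurable hp).trans ?_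
    gcongr

lemma sum_pow_three_le (v : ℕ → ℝ≥0∞) (M : ℕ) :
    (∑ n ∈ Finset.range M, v n) ^ 3
      ≤ 3 * ∑ m ∈ Finset.range M, v m * (∑ n ∈ Finset.range (m + 1), v n) ^ 2 := by
  induction M with
  | zero => simp
  | succ M ih =>
    rw [Finset.sum_range_succ (fun m => v m * _) M, mul_add, Finset.sum_range_succ v M]
    set S := ∑ n ∈ Finset.range M, v n
    calc (S + v M) ^ 3 ≤ S ^ 3 + 3 * (v M * (S + v M) ^ 2) := by
          have e1 : (S + v M) ^ 3 = S ^ 3 + (3 * v M * S ^ 2 + 3 * v M ^ 2 * S + v M ^ 3) := by ring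
          have e2 : 3 * (v M * (S + v M) ^ 2) = (3 * v M * S ^ 2 + 3 * v M ^ 2 * S + v M ^ 3)
            + (3 * v M ^ 2 * S + 2 * v M ^ 3) := by ring
          rw [e1, e2]
          exact add_le_add le_rfl le_self_add
      _ ≤ _ := by gcongr

/-- Combining fixed-time `L²` bounds with maximal functions, at one time. -/
lemma lintegral_sum_pow_six_le {X : Type*} [MeasurableSpace X] {μ : Measure X}
    {v : ℕ → X → ℝ≥0∞} (hv : ∀ n, Measurable (v n)) {c β : ℕ → ℝ≥0∞}
    (hc : ∀ n x, v n x ≤ c n) (hβ : ∀ n, ∫⁻ x, v n x ^ 2 ∂μ ≤ β n ^ 2) (M : ℕ) :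
    (∫⁻ x, (∑ n ∈ Finset.range M, v n x) ^ (6 : ℝ) ∂μ) ^ (1 / 2 : ℝ)
      ≤ 3 * ∑ m ∈ Finset.range M, β m * (∑ n ∈ Finset.range (m + 1), c n) ^ 2 := by
  set C : ℕ → ℝ≥0∞ := fun m => ∑ n ∈ Finset.range (m + 1), c n
  have h1 : ∀ x, (∑ n ∈ Finset.range M, v n x) ^ (6 : ℝ)
      ≤ (∑ m ∈ Finset.range M, 3 * C m ^ 2 * v m x) ^ (2 : ℝ) := fun x => by
    rw [show (6 : ℝ) = ((3 : ℕ) : ℝ) * 2 by norm_num, ENNReal.rpow_mul, ENNReal.rpow_natCast]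
    gcongr
    refine (sum_pow_three_le (fun n => v n x) M).trans ?_
    rw [Finset.mul_sum]
    refine Finset.sum_le_sum fun m _ => ?_
    rw [mul_assoc, mul_comm (v m x)]
    gcongr
    exact Finset.sum_le_sum fun n _ => hc n x
  calc _ ≤ (∫⁻ x, (∑ m ∈ Finset.range M, 3 * C m ^ 2 * v m x) ^ (2 : ℝ) ∂μ) ^ (1 / 2 : ℝ) := by
        gcongr with x
        exact h1 x
    _ ≤ ∑ m ∈ Finset.range M, (∫⁻ x, (3 * C m ^ 2 * v m x) ^ (2 : ℝ) ∂μ) ^ (1 / 2 : ℝ) :=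
        lintegral_Lp_sum_le (by norm_num) _ fun m => (hv m).const_mul _
    _ ≤ ∑ m ∈ Finset.range M, 3 * C m ^ 2 * β m := by
        refine Finset.sum_le_sum fun m _ => ?_
        have : ∫⁻ x, (3 * C m ^ 2 * v m x) ^ (2 : ℝ) ∂μ ≤ (3 * C m ^ 2 * β m) ^ (2 : ℝ) := by
          simp_rw [ENNReal.rpow_two, mul_pow (3 * C m ^ 2)]
          rw [lintegral_const_mul _ ((hv m).pow_const 2)]
          gcongr
          exact hβ m
        calc _ ≤ ((3 * C m ^ 2 * β m) ^ (2 : ℝ)) ^ (1 / 2 : ℝ) := by gcongr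
          _ = _ := by rw [← ENNReal.rpow_mul]; norm_num
    _ = _ := by
        rw [Finset.mul_sum]
        refine Finset.sum_congr rfl fun m _ => ?_
        ring

lemma lintegral_sum_sq_le {c : ℕ → ℝ → ℝ≥0∞} (hc : ∀ n, Measurable (c n)) {γ : ℕ → ℝ≥0∞}
    (hγ : ∀ n, ∫⁻ t, c n t ^ 2 ≤ γ n ^ 2) (s : Finset ℕ) :
    ∫⁻ t, (∑ n ∈ s, c n t) ^ 2 ≤ (∑ n ∈ s, γ n) ^ 2 := by
  have h := lintegral_Lp_sum_le (μ := (volume : Measure ℝ)) (p := 2) (by norm_num) s hc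
  have h2 : ∑ n ∈ s, (∫⁻ t, c n t ^ (2 : ℝ)) ^ (1 / 2 : ℝ) ≤ ∑ n ∈ s, γ n := by
    refine Finset.sum_le_sum fun n _ => ?_
    calc _ ≤ ((γ n) ^ (2 : ℝ)) ^ (1 / 2 : ℝ) := by
          gcongr
          simpa using hγ n
      _ = _ := by rw [← ENNReal.rpow_mul]; norm_num
  have h3 := ENNReal.rpow_le_rpow (h.trans h2) (by norm_num : (0 : ℝ) ≤ 2)
  rw [← ENNReal.rpow_mul] at h3
  norm_num at h3
  exact h3

/-- Combining fixed-time `L²` bounds with maximal functions, in `L³_t L⁶_x`. -/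
lemma lintegral_lintegral_sum_pow_six_le {v : ℕ → ℝ → E2 → ℝ≥0∞}
    (hv : ∀ n, Measurable (Function.uncurry (v n))) {c : ℕ → ℝ → ℝ≥0∞}
    (hcm : ∀ n, Measurable (c n)) {β γ : ℕ → ℝ≥0∞}
    (hc : ∀ n t x, v n t x ≤ c n t) (hβ : ∀ n t, ∫⁻ x, v n t x ^ 2 ≤ β n ^ 2)
    (hγ : ∀ n, ∫⁻ t, c n t ^ 2 ≤ γ n ^ 2) (M : ℕ) :
    ∫⁻ t, (∫⁻ x, (∑ n ∈ Finset.range M, v n t x) ^ (6 : ℝ)) ^ (1 / 2 : ℝ)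
      ≤ 3 * ∑ m ∈ Finset.range M, β m * (∑ n ∈ Finset.range (m + 1), γ n) ^ 2 := by
  calc _ ≤ ∫⁻ t, 3 * ∑ m ∈ Finset.range M, β m * (∑ n ∈ Finset.range (m + 1), c n t) ^ 2 :=
        lintegral_mono fun t => lintegral_sum_pow_six_le
          (fun n => (hv n).comp (measurable_const.prodMk measurable_id)) (fun n => hc n t)
          (fun n => hβ n t) M
    _ = 3 * ∑ m ∈ Finset.range M, β m * ∫⁻ t, (∑ n ∈ Finset.range (m + 1), c n t) ^ 2 := by
        have hS : ∀ m, Measurable fun t => (∑ n ∈ Finset.range (m + 1), c n t) ^ 2 := fun m =>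
          (Finset.measurable_fun_sum _ fun n _ => hcm n).pow_const 2
        rw [lintegral_const_mul _ (Finset.measurable_fun_sum _ fun m _ => (hS m).const_mul _),
          lintegral_finsetSum _ fun m _ => (hS m).const_mul _]
        simp_rw [lintegral_const_mul _ (hS _)]
    _ ≤ _ := by
        gcongr
        exact lintegral_sum_sq_le hcm hγ _

/-- A discrete Young inequality with geometric weights. -/
lemma sum_geometric_sq_le {q : ℝ} (hq0 : 0 < q) (hq1 : q < 1) {a : ℕ → ℝ} (M : ℕ) :
    ∑ m ∈ Finset.range M, (∑ n ∈ Finset.range (m + 1), q ^ (m - n) * a n) ^ 2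
      ≤ (1 - q)⁻¹ ^ 2 * ∑ n ∈ Finset.range M, a n ^ 2 := by
  set T : ℕ → ℝ := fun m => ∑ n ∈ Finset.range (m + 1), q ^ (m - n) * a n with hT
  have hrec : ∀ m, T (m + 1) = q * T m + a (m + 1) := fun m => by
    simp only [hT]
    rw [Finset.sum_range_succ, Finset.mul_sum]
    congr 1
    · refine Finset.sum_congr rfl fun n hn => ?_
      rw [Nat.succ_sub (by simp at hn; omega), pow_succ]
      ring
    · simp
  have h1q : 0 < 1 - q := by linarith
  have hsq : ∀ x y : ℝ, (q * x + y) ^ 2 ≤ q * x ^ 2 + (1 - q)⁻¹ * y ^ 2 := fun x y => by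
    have e : q * x ^ 2 + (1 - q)⁻¹ * y ^ 2 - (q * x + y) ^ 2
        = q * (1 - q)⁻¹ * ((1 - q) * x - y) ^ 2 := by
      field_simp
      ring
    have : 0 ≤ q * (1 - q)⁻¹ * ((1 - q) * x - y) ^ 2 := by positivity
    linarith
  have hmain : ∀ M, ∑ m ∈ Finset.range (M + 1), T m ^ 2 + q * (1 - q)⁻¹ * T M ^ 2
      ≤ (1 - q)⁻¹ ^ 2 * ∑ n ∈ Finset.range (M + 1), a n ^ 2 := fun M => by
    induction M with
    | zero =>
      simp only [hT]
      simp only [zero_add, Finset.sum_range_one, Nat.sub_zero, pow_zero, one_mul]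
      have h2 : 1 ≤ (1 - q)⁻¹ := (one_le_inv₀ h1q).2 (by linarith)
      have e : a 0 ^ 2 + q * (1 - q)⁻¹ * a 0 ^ 2 = (1 - q)⁻¹ * a 0 ^ 2 := by
        field_simp; ring
      rw [e]
      gcongr
      nlinarith
    | succ M ih =>
      rw [Finset.sum_range_succ, Finset.sum_range_succ _ (M + 1), mul_add]
      have h := hsq (T M) (a (M + 1))
      rw [← hrec] at h
      have h2 := mul_le_mul_of_nonneg_left h (inv_nonneg.2 h1q.le)
      have e1 : (1 - q)⁻¹ * T (M + 1) ^ 2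
          = T (M + 1) ^ 2 + q * (1 - q)⁻¹ * T (M + 1) ^ 2 := by
        field_simp; ring
      nlinarith
  cases M with
  | zero => simp
  | succ M =>
    have : 0 ≤ q * (1 - q)⁻¹ * T M ^ 2 := by positivity
    linarith [hmain M]

/-- Fatou's lemma for mixed Lebesgue norms. -/
lemma lintegral_lintegral_rpow_le_of_tendsto {F : ℕ → ℝ → E2 → ℝ≥0∞} {G : ℝ → E2 → ℝ≥0∞}
    (hF : ∀ M, Measurable (Function.uncurry (F M)))
    (hlim : ∀ t x, Filter.Tendsto (fun M => F M t x) Filter.atTop (nhds (G t x)))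
    {p r : ℝ} (hr : 0 < r) {K : ℝ≥0∞}
    (hK : ∀ M, ∫⁻ t, (∫⁻ x, F M t x ^ p) ^ r ≤ K) :
    ∫⁻ t, (∫⁻ x, G t x ^ p) ^ r ≤ K := by
  have h1 : ∀ t, ∫⁻ x, G t x ^ p ≤ Filter.liminf (fun M => ∫⁻ x, F M t x ^ p) Filter.atTop := by
    intro t
    have e : ∀ x, G t x ^ p = Filter.liminf (fun M => F M t x ^ p) Filter.atTop := fun x =>
      (((ENNReal.continuous_rpow_const (y := p)).tendsto _).comp (hlim t x)).liminf_eq.symm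
    simp_rw [e]
    exact lintegral_liminf_le fun M =>
      ((hF M).comp (measurable_const.prodMk measurable_id)).pow_const p
  have h2 : ∀ t, (∫⁻ x, G t x ^ p) ^ r
      ≤ Filter.liminf (fun M => (∫⁻ x, F M t x ^ p) ^ r) Filter.atTop := fun t => by
    refine (ENNReal.rpow_le_rpow (h1 t) hr.le).trans (le_of_eq ?_)
    exact (ENNReal.orderIsoRpow r hr).liminf_apply
  refine (lintegral_mono h2).trans ((lintegral_liminf_le fun M => ?_).trans ?_)
  · exact (Measurable.lintegral_prod_right' (f := fun z : ℝ × E2 => F M z.1 z.2 ^ p)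
      ((hF M).pow_const p)).pow_const r
  · exact Filter.liminf_le_of_le (by isBoundedDefault) fun b hb => by
      obtain ⟨M, hM⟩ := hb.exists
      exact hM.trans (hK M)

/-- The superposition of plane waves with density `g`. -/
def waveIntegral (s : ℝ) (g : ℝ × E2 → ℂ) (t : ℝ) (x : E2) : ℂ :=
  ∫ q, planeWave s t x q * g q

lemma integrable_planeWave_mul (s t : ℝ) (x : E2) {g : ℝ × E2 → ℂ} (hg : Integrable g) :
    Integrable fun q => planeWave s t x q * g q :=
  hg.bdd_mul (c := 1) (((continuous_planeWave s).comp
    (by fun_prop : Continuous fun q : ℝ × E2 => ((t, x), q))).aestronglyMeasurable)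
    (ae_of_all _ fun q => (norm_planeWave s t x q).le)

lemma continuous_waveIntegral (s : ℝ) {g : ℝ × E2 → ℂ} (hg : Integrable g) :
    Continuous (Function.uncurry (waveIntegral s g)) := by
  unfold Function.uncurry waveIntegral
  refine continuous_of_dominated (bound := fun q => ‖g q‖)
    (fun p => (integrable_planeWave_mul s p.1 p.2 hg).aestronglyMeasurable)
    (fun p => ae_of_all _ fun q => ?_) hg.norm (ae_of_all _ fun q => ?_)
  · rw [norm_mul, norm_planeWave, one_mul]
  · exact ((continuous_planeWave s).comp
      (by fun_prop : Continuous fun p : ℝ × E2 => (p, q))).mul continuous_const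

lemma sum_waveIntegral {ι : Type*} (S : Finset ι) (s : ℝ) {g : ι → ℝ × E2 → ℂ}
    (hg : ∀ i, Integrable (g i)) (t : ℝ) (x : E2) :
    ∑ i ∈ S, waveIntegral s (g i) t x = waveIntegral s (fun q => ∑ i ∈ S, g i q) t x := by
  unfold waveIntegral
  rw [← integral_finsetSum _ fun i _ => integrable_planeWave_mul s t x (hg i)]
  simp_rw [Finset.mul_sum]

lemma tendsto_waveIntegral (s : ℝ) {G : ℕ → ℝ × E2 → ℂ} {g : ℝ × E2 → ℂ} (hg : Integrable g)
    (hGm : ∀ M, Integrable (G M)) (hG : ∀ M q, ‖G M q‖ ≤ ‖g q‖)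
    (hlim : ∀ q, Filter.Tendsto (fun M => G M q) Filter.atTop (nhds (g q))) (t : ℝ) (x : E2) :
    Filter.Tendsto (fun M => waveIntegral s (G M) t x) Filter.atTop
      (nhds (waveIntegral s g t x)) := by
  refine tendsto_integral_of_dominated_convergence (fun q => ‖g q‖)
    (fun M => (integrable_planeWave_mul s t x (hGm M)).aestronglyMeasurable) hg.norm
    (fun M => ae_of_all _ fun q => ?_) (ae_of_all _ fun q => (hlim q).const_mul _)
  rw [norm_mul, norm_planeWave, one_mul]
  exact hG M q

/-- The dyadic level of a frequency. -/
def freqLevel (ξ : E2) : ℕ := Nat.size ⌊‖ξ‖⌋₊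

lemma measurable_freqLevel : Measurable freqLevel :=
  (measurable_from_top (f := Nat.size)).comp (Nat.measurable_floor.comp measurable_norm)

lemma norm_lt_two_pow_freqLevel (ξ : E2) : ‖ξ‖ < 2 ^ freqLevel ξ := by
  have h := Nat.lt_size_self ⌊‖ξ‖⌋₊
  have h2 := (Nat.floor_lt (norm_nonneg ξ)).1 h
  exact_mod_cast h2

lemma jap_pos (x : ℝ) : 0 < jap x := Real.sqrt_pos.2 (by positivity)

lemma le_jap (x : ℝ) : x ≤ jap x := Real.le_sqrt_of_sq_le (by linarith)

lemma one_le_jap (x : ℝ) : 1 ≤ jap x := Real.one_le_sqrt.2 (by nlinarith [sq_nonneg x])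

lemma continuous_jap : Continuous jap := by unfold jap; fun_prop

lemma two_pow_freqLevel_le (ξ : E2) : (2 : ℝ) ^ freqLevel ξ ≤ 2 * jap ‖ξ‖ := by
  rcases h : freqLevel ξ with _ | n
  · have := one_le_jap ‖ξ‖
    norm_num
    linarith
  · have h1 : n < Nat.size ⌊‖ξ‖⌋₊ := by
      have : Nat.size ⌊‖ξ‖⌋₊ = n + 1 := h
      omega
    have h2 : ((2 ^ n : ℕ) : ℝ) ≤ ‖ξ‖ := Nat.le_floor_iff (norm_nonneg _) |>.1 (Nat.lt_size.1 h1)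
    have h3 := le_jap ‖ξ‖
    push_cast at h2
    rw [pow_succ]
    linarith

/-- The part of `g` at frequency level `n`. -/
def freqPiece (g : ℝ × E2 → ℂ) (n : ℕ) : ℝ × E2 → ℂ :=
  {q | freqLevel q.2 = n}.indicator g

lemma measurableSet_freqLevel (n : ℕ) : MeasurableSet {q : ℝ × E2 | freqLevel q.2 = n} :=
  (measurable_freqLevel.comp measurable_snd) (measurableSet_singleton n)

lemma sum_freqPiece (g : ℝ × E2 → ℂ) (M : ℕ) (q : ℝ × E2) :
    ∑ n ∈ Finset.range M, freqPiece g n q = if freqLevel q.2 < M then g q else 0 := by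
  simp only [freqPiece, Set.indicator_apply, Set.mem_ofPred_eq]
  rw [Finset.sum_ite_eq]
  simp

lemma freqPiece_ne_zero {g : ℝ × E2 → ℂ} {n : ℕ} {q : ℝ × E2} (h : freqPiece g n q ≠ 0) :
    freqLevel q.2 = n ∧ g q ≠ 0 := by
  simp only [freqPiece, Set.indicator_apply, Set.mem_ofPred_eq] at h
  split_ifs at h with h1
  · exact ⟨h1, h⟩
  · exact absurd rfl h

/-- The squared weighted `L²` norm `∫ ⟨ξ⟩ |g|²`. -/
def weightedSq (g : ℝ × E2 → ℂ) : ℝ≥0∞ :=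
  ∫⁻ q, ENNReal.ofReal (jap ‖q.2‖) * ‖g q‖ₑ ^ 2

lemma measurable_weight {g : ℝ × E2 → ℂ} (hg : Measurable g) :
    Measurable fun q : ℝ × E2 => ENNReal.ofReal (jap ‖q.2‖) * ‖g q‖ₑ ^ 2 := by
  have : Measurable fun q : ℝ × E2 => jap ‖q.2‖ := (continuous_jap.comp (by fun_prop)).measurable
  fun_prop

lemma weightedSq_freqPiece (g : ℝ × E2 → ℂ) (n : ℕ) :
    weightedSq (freqPiece g n) = ∫⁻ q in {q | freqLevel q.2 = n},
      ENNReal.ofReal (jap ‖q.2‖) * ‖g q‖ₑ ^ 2 := by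
  rw [← lintegral_indicator (measurableSet_freqLevel n)]
  refine lintegral_congr fun q => ?_
  by_cases h : freqLevel q.2 = n <;> simp [freqPiece, h]

lemma sum_weightedSq_freqPiece_le {g : ℝ × E2 → ℂ} (M : ℕ) :
    ∑ n ∈ Finset.range M, weightedSq (freqPiece g n) ≤ weightedSq g := by
  simp_rw [weightedSq_freqPiece]
  rw [← lintegral_biUnion_finset (fun i _ j _ hij => ?_) fun n _ => measurableSet_freqLevel n]
  · exact setLIntegral_le_lintegral _ _
  · rw [Function.onFun, Set.disjoint_left]
    intro q h1 h2
    exact hij (h1.symm.trans h2)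

lemma lintegral_freqPiece_le {g : ℝ × E2 → ℂ} (hg : Measurable g) (n : ℕ) :
    ∫⁻ q, ‖freqPiece g n q‖ₑ ^ 2
      ≤ ENNReal.ofReal (2 / 2 ^ n) * weightedSq (freqPiece g n) := by
  have hgn : Measurable (freqPiece g n) := hg.indicator (measurableSet_freqLevel n)
  rw [weightedSq, ← lintegral_const_mul _ (measurable_weight hgn)]
  refine lintegral_mono fun q => ?_
  by_cases h : freqPiece g n q = 0
  · simp [h]
  obtain ⟨h1, -⟩ := freqPiece_ne_zero h
  dsimp only
  rw [← mul_assoc, ← ENNReal.ofReal_mul (by positivity)]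
  refine le_mul_of_one_le_left (zero_le) ?_
  rw [ENNReal.one_le_ofReal, div_mul_eq_mul_div, one_le_div₀ (by positivity), ← h1]
  exact two_pow_freqLevel_le _

/-- The `L³_t L⁶_x` estimate at a fixed modulation scale. -/
lemma exists_lintegral_waveIntegral_le :
    ∃ C : ℝ, 0 < C ∧ ∀ s : ℝ, |s| = 1 → ∀ L : ℝ, 0 < L → ∀ g : ℝ × E2 → ℂ, Measurable g →
      Integrable g → (∀ q, g q ≠ 0 → |q.1| ≤ 2 * L) → ∀ a : ℝ, 0 ≤ a →
      weightedSq g ≤ ENNReal.ofReal (a ^ 2) →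
      ∫⁻ t, (∫⁻ x, ‖waveIntegral s g t x‖ₑ ^ (6 : ℝ)) ^ (1 / 2 : ℝ)
        ≤ ENNReal.ofReal (C * L * a ^ 3) := by
  set K₁ : ℝ := 8 * Real.sqrt Real.pi * Real.pi ^ 2 * Real.exp 2 with hK₁
  set K₂ : ℝ := 4 * Real.sqrt Real.pi * Real.pi * Real.Gamma (1 / 4) * Real.exp 2 with hK₂
  have hpi := Real.pi_pos
  have hG : 0 < Real.Gamma (1 / 4) := Real.Gamma_pos_of_pos (by norm_num)
  have hK₁0 : 0 < K₁ := by positivity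
  have hK₂0 : 0 < K₂ := by positivity
  set r : ℝ := Real.sqrt (Real.sqrt 2) with hr
  have hr1 : 1 < r := by
    rw [hr, Real.lt_sqrt (by norm_num), Real.lt_sqrt (by norm_num)]; norm_num
  have hr0 : 0 < r := by linarith
  have hr4 : r ^ 4 = 2 := by
    rw [show r ^ 4 = (r ^ 2) ^ 2 by ring, hr, Real.sq_sqrt (by positivity),
      Real.sq_sqrt (by positivity)]
  have hq1 : r⁻¹ < 1 := inv_lt_one_of_one_lt₀ hr1
  have hq0 : 0 < r⁻¹ := by positivity
  have h1q : 0 < 1 - r⁻¹ := by linarith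
  refine ⟨3 * Real.sqrt (2 * K₁) * (2 * K₂) * (1 - r⁻¹)⁻¹ ^ 2, by positivity,
    fun s hs L hL g hg hgi hsupp a ha hga => ?_⟩
  have hsL : 0 < Real.sqrt L := Real.sqrt_pos.2 hL
  have hgn : ∀ n, Measurable (freqPiece g n) := fun n => hg.indicator (measurableSet_freqLevel n)
  have hgni : ∀ n, Integrable (freqPiece g n) := fun n => hgi.indicator (measurableSet_freqLevel n)
  have hsum : ∀ M, ∑ n ∈ Finset.range M, weightedSq (freqPiece g n) ≤ ENNReal.ofReal (a ^ 2) :=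
    fun M => (sum_weightedSq_freqPiece_le M).trans hga
  have hle : ∀ n, weightedSq (freqPiece g n) ≤ ENNReal.ofReal (a ^ 2) := fun n =>
    (Finset.single_le_sum (f := fun n => weightedSq (freqPiece g n)) (fun _ _ => zero_le)
      (Finset.self_mem_range_succ n)).trans (hsum (n + 1))
  set b : ℕ → ℝ := fun n => Real.sqrt (weightedSq (freqPiece g n)).toReal with hb
  have hb0 : ∀ n, 0 ≤ b n := fun n => Real.sqrt_nonneg _
  have hbsq : ∀ n, weightedSq (freqPiece g n) = ENNReal.ofReal (b n ^ 2) := fun n => by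
    rw [hb, Real.sq_sqrt ENNReal.toReal_nonneg,
      ENNReal.ofReal_toReal ((hle n).trans_lt ENNReal.ofReal_lt_top).ne]
  have hbsum : ∀ M, ∑ n ∈ Finset.range M, b n ^ 2 ≤ a ^ 2 := fun M => by
    have := hsum M
    simp_rw [hbsq] at this
    rwa [← ENNReal.ofReal_sum_of_nonneg fun _ _ => sq_nonneg _,
      ENNReal.ofReal_le_ofReal_iff (sq_nonneg a)] at this
  have hpow : ∀ n : ℕ, (2 : ℝ) ^ n = (r ^ n) ^ 4 := fun n => by
    rw [← hr4, ← pow_mul, ← pow_mul, mul_comm]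
  have hl2 : ∀ n, ∫⁻ q, ‖freqPiece g n q‖ₑ ^ 2 ≤ ENNReal.ofReal (2 / (r ^ n) ^ 4 * b n ^ 2) :=
    fun n => by
      have := lintegral_freqPiece_le hg n
      rwa [hbsq, ← ENNReal.ofReal_mul (by positivity), hpow] at this
  set U : ℕ → ℝ → E2 → ℂ := fun n => waveIntegral s (freqPiece g n) with hU
  have hUc : ∀ n, Continuous (Function.uncurry (U n)) := fun n => continuous_waveIntegral s (hgni n)
  set β : ℕ → ℝ := fun n => Real.sqrt (2 * K₁) * Real.sqrt L * a * (r⁻¹ ^ n) ^ 2 with hβ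
  set γ : ℕ → ℝ := fun n => Real.sqrt (2 * K₂ * Real.sqrt L) * r ^ n * b n with hγ
  have hβ0 : ∀ n, 0 ≤ β n := fun n => by positivity
  have hγ0 : ∀ n, 0 ≤ γ n := fun n => by have := hb0 n; positivity
  have hspace : ∀ n t, ∫⁻ x, ‖U n t x‖ₑ ^ 2 ≤ ENNReal.ofReal (β n) ^ 2 := fun n t => by
    have h := lintegral_space_planeWave_le s t hL (δ := ((2 ^ n) ^ 2)⁻¹) (by positivity)
      (hgn n) (hgni n) (fun q hq => by
        obtain ⟨h1, h2⟩ := freqPiece_ne_zero hq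
        refine ⟨hsupp q h2, ?_⟩
        rw [inv_mul_le_iff₀ (by positivity), mul_one, ← h1]
        exact pow_le_pow_left₀ (norm_nonneg _) (norm_lt_two_pow_freqLevel _).le 2)
    refine h.trans ((mul_le_mul_right (hl2 n) _).trans ?_)
    rw [← ENNReal.ofReal_mul (by positivity), ← ENNReal.ofReal_pow (hβ0 n)]
    refine ENNReal.ofReal_le_ofReal ?_
    have hba : b n ^ 2 ≤ a ^ 2 := (Finset.single_le_sum (f := fun n => b n ^ 2)
      (fun _ _ => sq_nonneg _) (Finset.self_mem_range_succ n)).trans (hbsum (n + 1))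
    have e : β n ^ 2 = K₁ * L * (2 / (r ^ n) ^ 4 * a ^ 2) := by
      rw [hβ]
      simp only [mul_pow]
      rw [Real.sq_sqrt (by positivity), Real.sq_sqrt (by positivity), inv_pow]
      field_simp
    rw [e]
    gcongr
  have htime : ∀ n, ∃ c : ℝ → ℝ≥0∞, Measurable c ∧ (∀ t x, ‖U n t x‖ₑ ≤ c t) ∧
      ∫⁻ t, c t ^ 2 ≤ ENNReal.ofReal (γ n) ^ 2 := fun n => by
    refine exists_maximal_function (hUc n).measurable
      (fun t => (hUc n).comp (by fun_prop : Continuous fun x : E2 => (t, x))) fun X hX => ?_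
    have h := lintegral_time_planeWave_le hs hX hL (ε := (2 ^ n)⁻¹) (by positivity)
      (hgn n) (hgni n) (fun q hq => by
        obtain ⟨h1, h2⟩ := freqPiece_ne_zero hq
        refine ⟨hsupp q h2, ?_⟩
        rw [inv_mul_le_iff₀ (by positivity), mul_one, ← h1]
        exact (norm_lt_two_pow_freqLevel _).le)
    refine h.trans ((mul_le_mul_right (hl2 n) _).trans (le_of_eq ?_))
    rw [← ENNReal.ofReal_mul (by positivity), ← ENNReal.ofReal_pow (hγ0 n)]
    congr 1
    have e : Real.sqrt (2 ^ n)⁻¹ = ((r ^ n) ^ 2)⁻¹ := by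
      rw [hpow, show ((r ^ n) ^ 4)⁻¹ = (((r ^ n) ^ 2)⁻¹) ^ 2 by rw [inv_pow]; ring_nf,
        Real.sqrt_sq (by positivity)]
    rw [e, hpow, hγ]
    simp only [mul_pow]
    rw [Real.sq_sqrt (by positivity : 0 ≤ 2 * K₂ * Real.sqrt L), hK₂]
    field_simp
  choose c hcm hc hcγ using htime
  have hpart : ∀ M, ∫⁻ t, (∫⁻ x, (‖∑ n ∈ Finset.range M, U n t x‖ₑ) ^ (6 : ℝ)) ^ (1 / 2 : ℝ)
      ≤ ENNReal.ofReal (3 * Real.sqrt (2 * K₁) * (2 * K₂) * (1 - r⁻¹)⁻¹ ^ 2 * L * a ^ 3) := by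
    intro M
    have h := lintegral_lintegral_sum_pow_six_le (v := fun n t x => ‖U n t x‖ₑ)
      (fun n => (hUc n).measurable.enorm) hcm hc hspace hcγ M
    refine le_trans (lintegral_mono fun t => ?_) (h.trans ?_)
    · gcongr with x
      exact enorm_sum_le _ _
    · simp_rw [← ENNReal.ofReal_sum_of_nonneg fun n _ => hγ0 n,
        ← ENNReal.ofReal_pow (Finset.sum_nonneg fun n _ => hγ0 n),
        ← ENNReal.ofReal_mul (hβ0 _)]
      rw [← ENNReal.ofReal_sum_of_nonneg fun m _ => mul_nonneg (hβ0 m) (sq_nonneg _),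
        show (3 : ℝ≥0∞) = ENNReal.ofReal 3 by simp, ← ENNReal.ofReal_mul (by norm_num)]
      refine ENNReal.ofReal_le_ofReal ?_
      have e : ∀ m, β m * (∑ n ∈ Finset.range (m + 1), γ n) ^ 2
          = (Real.sqrt (2 * K₁) * (2 * K₂) * L * a) *
            (∑ n ∈ Finset.range (m + 1), r⁻¹ ^ (m - n) * b n) ^ 2 := fun m => by
        have e1 : ∑ n ∈ Finset.range (m + 1), r⁻¹ ^ (m - n) * b n
            = r⁻¹ ^ m * ∑ n ∈ Finset.range (m + 1), r ^ n * b n := by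
          rw [Finset.mul_sum]
          refine Finset.sum_congr rfl fun n hn => ?_
          have hn' : n ≤ m := by simp at hn; omega
          rw [← mul_assoc]
          congr 1
          have : r⁻¹ ^ m = r⁻¹ ^ (m - n) * r⁻¹ ^ n := by rw [← pow_add]; congr 1; omega
          rw [this, mul_assoc, ← mul_pow, inv_mul_cancel₀ hr0.ne', one_pow, mul_one]
        have e2 : ∑ n ∈ Finset.range (m + 1), γ n
            = Real.sqrt (2 * K₂ * Real.sqrt L) * ∑ n ∈ Finset.range (m + 1), r ^ n * b n := by
          rw [Finset.mul_sum]
          exact Finset.sum_congr rfl fun n _ => by rw [hγ]; ring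
        rw [e1, e2, hβ]
        simp only [mul_pow]
        rw [Real.sq_sqrt (by positivity)]
        nth_rewrite 3 [← Real.mul_self_sqrt hL.le]
        ring
      simp_rw [e]
      rw [← Finset.mul_sum]
      have h1 := (sum_geometric_sq_le hq0 hq1 (a := b) M).trans
        (mul_le_mul_of_nonneg_left (hbsum M) (by positivity))
      calc _ ≤ 3 * (Real.sqrt (2 * K₁) * (2 * K₂) * L * a * ((1 - r⁻¹)⁻¹ ^ 2 * a ^ 2)) := by gcongr
        _ = _ := by ring
  refine lintegral_lintegral_rpow_le_of_tendsto
    (F := fun M t x => ‖∑ n ∈ Finset.range M, U n t x‖ₑ)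
    (fun M => ?_) (fun t x => ?_) (by norm_num) hpart
  · exact (Finset.measurable_fun_sum _ fun n _ => (hUc n).measurable).enorm
  · refine Filter.Tendsto.enorm ?_
    simp_rw [hU, sum_waveIntegral _ s hgni]
    refine tendsto_waveIntegral s hgi (fun M => integrable_finsetSum _ fun n _ => hgni n)
      (fun M q => ?_) (fun q => ?_) t x
    · rw [sum_freqPiece]
      split_ifs <;> simp
    · refine tendsto_const_nhds.congr' ?_
      filter_upwards [Filter.eventually_gt_atTop (freqLevel q.2)] with M hM
      rw [sum_freqPiece, if_pos hM]

namespace IsLPBump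

variable {φ : ℝ → ℝ}

lemma scaled_bounds (hφ : IsLPBump φ) {τ : ℝ} {j : ℤ} (h : φ (τ / 2 ^ j) ≠ 0) :
    (2 : ℝ) ^ j ≤ 2 * |τ| ∧ |τ| ≤ 2 * 2 ^ j := by
  obtain ⟨h1, h2⟩ := hφ.support_subset _ h
  have h2j : (0 : ℝ) < 2 ^ j := by positivity
  rw [abs_div, abs_of_pos h2j] at h1 h2
  rw [le_div_iff₀ h2j] at h1
  rw [div_le_iff₀ h2j] at h2
  constructor <;> linarith

lemma hasFiniteSupport_scaled (hφ : IsLPBump φ) (τ : ℝ) :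
    (Function.support fun j : ℤ => φ (τ / 2 ^ j)).Finite := by
  refine (Set.finite_Icc (Int.log 2 |τ| - 1) (Int.log 2 |τ| + 1)).subset fun j hj => ?_
  obtain ⟨h1, h2⟩ := hφ.scaled_bounds hj
  have h2j : (0 : ℝ) < 2 ^ j := by positivity
  have hτ : 0 < |τ| := by linarith
  have h3 := Int.zpow_log_le_self (b := 2) one_lt_two hτ
  have h4 := Int.lt_zpow_succ_log_self (b := 2) one_lt_two |τ|
  push_cast at h3 h4
  have h5 : (2 : ℝ) ^ Int.log 2 |τ| ≤ 2 ^ (j + 1) := by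
    rw [zpow_add_one₀ two_ne_zero]; linarith
  have h6 : (2 : ℝ) ^ j < 2 ^ (Int.log 2 |τ| + 1 + 1) := by
    rw [zpow_add_one₀ two_ne_zero (Int.log 2 |τ| + 1)]; linarith
  rw [zpow_le_zpow_iff_right₀ one_lt_two] at h5
  rw [zpow_lt_zpow_iff_right₀ one_lt_two] at h6
  constructor <;> omega

lemma summable_scaled (hφ : IsLPBump φ) (τ : ℝ) : Summable fun j : ℤ => φ (τ / 2 ^ j) :=
  summable_of_hasFiniteSupport (hφ.hasFiniteSupport_scaled τ)

lemma lpSum_pos (hφ : IsLPBump φ) {τ : ℝ} (hτ : τ ≠ 0) : 0 < lpSum φ τ := by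
  have hτ' : 0 < |τ| := abs_pos.2 hτ
  have h3 := Int.zpow_log_le_self (b := 2) one_lt_two hτ'
  have h4 := Int.lt_zpow_succ_log_self (b := 2) one_lt_two |τ|
  push_cast at h3 h4
  set e := Int.log 2 |τ|
  have he : (0 : ℝ) < 2 ^ e := by positivity
  have hs1 : 1 ≤ Real.sqrt 2 := Real.one_le_sqrt.2 one_le_two
  have hs2 : Real.sqrt 2 * Real.sqrt 2 = 2 := Real.mul_self_sqrt zero_le_two
  have key : ∃ j : ℤ, 0 < φ (τ / 2 ^ j) := by
    by_cases h : |τ| ≤ Real.sqrt 2 * 2 ^ e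
    · refine ⟨e, hφ.pos _ ?_ ?_⟩
      · rw [abs_div, abs_of_pos he, le_div_iff₀ he]
        refine le_trans (mul_le_of_le_one_left he.le ?_) h3
        rw [div_le_one (by positivity)]
        exact hs1
      · rw [abs_div, abs_of_pos he, div_le_iff₀ he]
        exact h
    · push Not at h
      refine ⟨e + 1, hφ.pos _ ?_ ?_⟩
      · rw [abs_div, abs_of_pos (by positivity : (0 : ℝ) < 2 ^ (e + 1)),
          le_div_iff₀ (by positivity),
          zpow_add_one₀ two_ne_zero]
        refine le_trans (le_of_eq ?_) h.le
        field_simp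
        linarith
      · rw [abs_div, abs_of_pos (by positivity : (0 : ℝ) < 2 ^ (e + 1)),
          div_le_iff₀ (by positivity)]
        refine h4.le.trans (le_mul_of_one_le_left (by positivity) hs1)
  obtain ⟨j, hj⟩ := key
  exact (hφ.summable_scaled τ).tsum_pos (fun _ => hφ.nonneg _) j hj

lemma lpSum_nonneg (hφ : IsLPBump φ) (τ : ℝ) : 0 ≤ lpSum φ τ :=
  tsum_nonneg fun _ => hφ.nonneg _

lemma summable_scaled_succ (hφ : IsLPBump φ) (τ : ℝ) :
    Summable fun k : ℕ => φ (τ / 2 ^ (k + 1)) := by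
  have h := (hφ.summable_scaled τ).comp_injective
    (i := fun k : ℕ => ((k + 1 : ℕ) : ℤ)) (fun a b h => by simpa using h)
  exact h.congr fun k => by rw [Function.comp_apply, zpow_natCast]

lemma tsum_scaled_succ_le (hφ : IsLPBump φ) (τ : ℝ) :
    ∑' k : ℕ, φ (τ / 2 ^ (k + 1)) ≤ lpSum φ τ := by
  have h := tsum_comp_le_tsum_of_inj (hφ.summable_scaled τ) (fun _ => hφ.nonneg _)
    (i := fun k : ℕ => ((k + 1 : ℕ) : ℤ)) (fun a b h => by simpa using h)
  refine le_trans (le_of_eq ?_) h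
  simp only [Function.comp_def, zpow_natCast]

lemma lpPiece_nonneg (hφ : IsLPBump φ) (k : ℕ) (τ : ℝ) : 0 ≤ lpPiece φ k τ := by
  cases k with
  | zero =>
    rw [lpPiece, tsum_div_const, sub_nonneg]
    exact div_le_one_of_le₀ (hφ.tsum_scaled_succ_le τ) (hφ.lpSum_nonneg τ)
  | succ k => exact div_nonneg (hφ.nonneg _) (hφ.lpSum_nonneg τ)

lemma hasSum_lpPiece (hφ : IsLPBump φ) (τ : ℝ) : HasSum (fun k => lpPiece φ k τ) 1 := by
  have h : HasSum (fun k => lpPiece φ (k + 1) τ) (∑' k : ℕ, lpPiece φ (k + 1) τ) :=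
    Summable.hasSum ((hφ.summable_scaled_succ τ).div_const _)
  have h2 := (hasSum_nat_add_iff (f := fun k => lpPiece φ k τ) 1).1 h
  have e : ∑' k : ℕ, lpPiece φ (k + 1) τ + ∑ k ∈ Finset.range 1, lpPiece φ k τ = 1 := by
    simp [lpPiece]
  rwa [e] at h2

lemma sum_lpPiece_le_one (hφ : IsLPBump φ) (M : ℕ) (τ : ℝ) :
    ∑ k ∈ Finset.range M, lpPiece φ k τ ≤ 1 :=
  sum_le_hasSum _ (fun k _ => hφ.lpPiece_nonneg k τ) (hφ.hasSum_lpPiece τ)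

lemma lpPiece_le_one (hφ : IsLPBump φ) (k : ℕ) (τ : ℝ) : lpPiece φ k τ ≤ 1 :=
  le_hasSum (hφ.hasSum_lpPiece τ) k fun j _ => hφ.lpPiece_nonneg j τ

lemma abs_le_of_lpPiece_ne_zero (hφ : IsLPBump φ) {k : ℕ} {τ : ℝ} (h : lpPiece φ k τ ≠ 0) :
    |τ| ≤ 2 * 2 ^ k := by
  cases k with
  | zero =>
    by_contra! hτ
    rw [pow_zero, mul_one] at hτ
    have hτ0 : τ ≠ 0 := fun h0 => by rw [h0, abs_zero] at hτ; linarith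
    refine h ?_
    have hinj : Function.Injective (fun k : ℕ => ((k + 1 : ℕ) : ℤ)) := fun a b h => by simpa using h
    have e := hinj.tsum_eq (f := fun j : ℤ => φ (τ / 2 ^ j)) (fun j hj => by
      obtain ⟨-, h2⟩ := hφ.scaled_bounds hj
      have : (2 : ℝ) ^ (0 : ℤ) < 2 ^ j := by rw [zpow_zero]; linarith
      rw [zpow_lt_zpow_iff_right₀ one_lt_two] at this
      exact ⟨(j - 1).toNat, by simp only; omega⟩)
    have e2 : ∑' k : ℕ, φ (τ / 2 ^ (k + 1)) = lpSum φ τ := by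
      rw [lpSum, ← e]
      simp only [zpow_natCast]
    rw [lpPiece, tsum_div_const, e2, div_self (hφ.lpSum_pos hτ0).ne', sub_self]
  | succ k =>
    have hne : φ (τ / 2 ^ ((k + 1 : ℕ) : ℤ)) ≠ 0 := fun h0 => h (by
      rw [zpow_natCast] at h0
      rw [lpPiece, h0, zero_div])
    have := (hφ.scaled_bounds hne).2
    rwa [zpow_natCast] at this

lemma two_pow_le_of_lpPiece_succ_ne_zero (hφ : IsLPBump φ) {k : ℕ} {τ : ℝ}
    (h : lpPiece φ (k + 1) τ ≠ 0) : (2 : ℝ) ^ k ≤ |τ| := by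
  have hne : φ (τ / 2 ^ ((k + 1 : ℕ) : ℤ)) ≠ 0 := fun h0 => h (by
    rw [zpow_natCast] at h0
    rw [lpPiece, h0, zero_div])
  have := (hφ.scaled_bounds hne).1
  rw [zpow_natCast, pow_succ] at this
  linarith

lemma measurable_tsum_scaled (hφ : IsLPBump φ) {ι : Type*} [Countable ι] (c : ι → ℝ) :
    Measurable fun τ => ∑' i, φ (τ / c i) := by
  have e : (fun τ => ∑' i, φ (τ / c i))
      = fun τ => (∑' i, ENNReal.ofReal (φ (τ / c i))).toReal := by
    funext τ
    rw [ENNReal.tsum_toReal_eq fun _ => ENNReal.ofReal_ne_top]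
    simp_rw [ENNReal.toReal_ofReal (hφ.nonneg _)]
  have hm := hφ.smooth.continuous.measurable
  rw [e]
  fun_prop

lemma measurable_lpPiece (hφ : IsLPBump φ) (k : ℕ) : Measurable (lpPiece φ k) := by
  have h1 : Measurable (lpSum φ) := hφ.measurable_tsum_scaled fun j : ℤ => 2 ^ j
  have hm := hφ.smooth.continuous.measurable
  cases k with
  | zero =>
    have h2 := hφ.measurable_tsum_scaled fun j : ℕ => 2 ^ (j + 1)
    have e : lpPiece φ 0 = fun τ => 1 - (∑' k : ℕ, φ (τ / 2 ^ (k + 1))) / lpSum φ τ := by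
      funext τ
      rw [lpPiece, tsum_div_const]
    rw [e]
    exact measurable_const.sub (h2.div h1)
  | succ k =>
    have e : lpPiece φ (k + 1) = fun τ => φ (τ / 2 ^ (k + 1)) / lpSum φ τ := by
      funext τ
      rw [lpPiece]
    rw [e]
    fun_prop

end IsLPBump

open scoped FourierTransform in
lemma exists_schwartzMap_eq_ftST (f : SchwartzMap SpaceTime ℂ) :
    ∃ G : SchwartzMap SpaceTime ℂ, (∀ τ ξ, ftST (fun p => f p) τ ξ = G (τ, ξ)) ∧
      ∀ t x, f (t, x) = (((2 * Real.pi) ^ 3)⁻¹ : ℝ) *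
        ∫ q : ℝ × E2, exp (I * ((t * q.1 + ⟪x, q.2⟫ : ℝ) : ℂ)) * G q := by
  set e := WithLp.prodContinuousLinearEquiv 2 ℝ ℝ E2 with he
  set F : SchwartzMap (WithLp 2 (ℝ × E2)) ℂ :=
    SchwartzMap.compCLMOfContinuousLinearEquiv ℂ e f with hF
  have hπ : (2 * Real.pi : ℝ) ≠ 0 := by positivity
  let m : SpaceTime ≃L[ℝ] SpaceTime :=
    (LinearEquiv.smulOfNeZero ℝ SpaceTime (2 * Real.pi)⁻¹ (inv_ne_zero hπ)).toContinuousLinearEquiv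
  set G : SchwartzMap SpaceTime ℂ :=
    SchwartzMap.compCLMOfContinuousLinearEquiv ℂ (m.trans e.symm) (𝓕 F) with hG
  have hGv : ∀ q, G q = 𝓕 (F : _ → ℂ) (WithLp.toLp 2 ((2 * Real.pi)⁻¹ • q)) := fun q => rfl
  have hemb : MeasurableEmbedding (@WithLp.toLp 2 (ℝ × E2)) :=
    (MeasurableEquiv.toLp 2 (ℝ × E2)).measurableEmbedding
  have hvp := WithLp.volume_preserving_toLp ℝ E2
  refine ⟨G, fun τ ξ => ?_, fun t x => ?_⟩
  · rw [hGv, Real.fourier_eq', ← hvp.integral_comp hemb, ftST]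
    refine integral_congr_ae (Filter.Eventually.of_forall fun p => ?_)
    have h1 : F (WithLp.toLp 2 p) = f p := rfl
    simp only [h1, smul_eq_mul]
    congr 2
    rw [WithLp.prod_inner_apply]
    simp only [Prod.smul_fst, Prod.smul_snd, inner_smul_right, smul_eq_mul]
    simp
    field_simp
  · have h1 : f (t, x) = 𝓕⁻ (𝓕 (F : _ → ℂ)) (WithLp.toLp 2 (t, x)) := by
      have h2 : 𝓕⁻ (𝓕 F) = F := FourierTransform.fourierInv_fourier_eq F
      have h3 : (𝓕⁻ (𝓕 F)) (WithLp.toLp 2 (t, x)) = f (t, x) := by rw [h2]; rfl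
      rw [← h3, SchwartzMap.fourierInv_coe, SchwartzMap.fourier_coe]
    have hfin : Module.finrank ℝ (ℝ × E2) = 3 := by
      simp [Module.finrank_prod]
    rw [h1, Real.fourierInv_eq', ← hvp.integral_comp hemb]
    have : (volume : Measure (ℝ × E2)).IsAddHaarMeasure :=
      Measure.prod.instIsAddHaarMeasure volume volume
    have h4 := Measure.integral_comp_smul (volume : Measure (ℝ × E2))
      (fun q : ℝ × E2 =>
        exp (((2 * Real.pi * ⟪WithLp.toLp 2 q, WithLp.toLp 2 (t, x)⟫ : ℝ) : ℂ) * I) •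
        𝓕 (F : _ → ℂ) (WithLp.toLp 2 q)) (2 * Real.pi)⁻¹
    rw [hfin] at h4
    have h5 : |(((2 * Real.pi)⁻¹ ^ 3)⁻¹ : ℝ)| = (2 * Real.pi) ^ 3 := by
      rw [abs_of_pos (by positivity), inv_pow, inv_inv]
    rw [h5] at h4
    have h6 : (∫ q : ℝ × E2, exp (I * ((t * q.1 + ⟪x, q.2⟫ : ℝ) : ℂ)) * G q) =
        ((2 * Real.pi) ^ 3 : ℝ) • ∫ q : ℝ × E2,
          exp (((2 * Real.pi * ⟪WithLp.toLp 2 q, WithLp.toLp 2 (t, x)⟫ : ℝ) : ℂ) * I) •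
        𝓕 (F : _ → ℂ) (WithLp.toLp 2 q) := by
      rw [← h4]
      refine integral_congr_ae (Filter.Eventually.of_forall fun p => ?_)
      simp only [hGv, smul_eq_mul]
      congr 2
      rw [WithLp.prod_inner_apply, mul_comm I]
      congr 2
      simp only [Prod.smul_fst, Prod.smul_snd, inner_smul_left, smul_eq_mul]
      simp [real_inner_comm]
      field_simp
    rw [h6, Complex.real_smul, ← mul_assoc, ← Complex.ofReal_mul, inv_mul_cancel₀ (by positivity)]
    simp

/-- The change of variables `(λ, ξ) ↦ (λ - s‖ξ‖, ξ)`, which straightens the light cone. -/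
def coneShear (s : ℝ) : SpaceTime ≃ₜ SpaceTime where
  toFun q := (q.1 - s * ‖q.2‖, q.2)
  invFun q := (q.1 + s * ‖q.2‖, q.2)
  left_inv q := by simp
  right_inv q := by simp
  continuous_toFun := by fun_prop
  continuous_invFun := by fun_prop

lemma measurePreserving_coneShear (s : ℝ) :
    MeasurePreserving (coneShear s) (volume : Measure SpaceTime) volume := by
  have h1 : MeasurePreserving (fun p : E2 × ℝ => (p.1, p.2 - s * ‖p.1‖))
      ((volume : Measure E2).prod (volume : Measure ℝ)) (volume.prod volume) :=
    (MeasurePreserving.id (volume : Measure E2)).skew_product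
      (g := fun ξ τ => τ - s * ‖ξ‖) (by unfold Function.uncurry; fun_prop)
      (Filter.Eventually.of_forall fun ξ =>
        (measurePreserving_sub_right (volume : Measure ℝ) (s * ‖ξ‖)).map_eq)
  exact (Measure.measurePreserving_swap.comp h1).comp Measure.measurePreserving_swap

/-- `(τ, ξ) ↦ G (τ, ξ)` in the coordinates `λ = τ + s‖ξ‖` adapted to the cone. -/
def coneCoord (s : ℝ) (G : SchwartzMap SpaceTime ℂ) (q : SpaceTime) : ℂ := G (coneShear s q)

lemma continuous_coneCoord (s : ℝ) (G : SchwartzMap SpaceTime ℂ) :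
    Continuous (coneCoord s G) := G.continuous.comp (coneShear s).continuous

lemma integrable_coneCoord (s : ℝ) (G : SchwartzMap SpaceTime ℂ) :
    Integrable (coneCoord s G) := by
  have hG : Integrable (G : SpaceTime → ℂ) (volume.prod volume) := G.integrable
  exact (measurePreserving_coneShear s).integrable_comp_of_integrable hG

lemma integral_exp_mul_eq_waveIntegral (s : ℝ) (G : SchwartzMap SpaceTime ℂ) (t : ℝ) (x : E2) :
    ∫ q : ℝ × E2, exp (I * ((t * q.1 + ⟪x, q.2⟫ : ℝ) : ℂ)) * G q =
      waveIntegral s (coneCoord s G) t x := by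
  rw [← (measurePreserving_coneShear s).integral_comp (coneShear s).measurableEmbedding]
  rfl

lemma jap_le_one_add {x : ℝ} (hx : 0 ≤ x) : jap x ≤ 1 + x := by
  refine Real.sqrt_le_iff.2 ⟨by positivity, by nlinarith⟩

lemma integrable_weight_mul_schwartzMap {s : ℝ} (hs : |s| = 1) (G : SchwartzMap SpaceTime ℂ) :
    Integrable (fun p : SpaceTime =>
      (1 + (p.1 + s * ‖p.2‖) ^ 2) * (jap ‖p.2‖ * ‖G p‖ ^ 2)) := by
  obtain ⟨B, hB⟩ : ∃ B, ∀ p, ‖G p‖ ≤ B  :=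
    ⟨SchwartzMap.seminorm ℝ 0 0 G, fun p => SchwartzMap.norm_le_seminorm ℝ G p⟩
  have : (volume : Measure SpaceTime).HasTemperateGrowth :=
    inferInstanceAs ((volume : Measure ℝ).prod (volume : Measure E2)).HasTemperateGrowth
  have hi := fun n => SchwartzMap.integrable_pow_mul (volume : Measure SpaceTime) G n
  have hwt := ((((hi 0).add (hi 1)).add ((hi 2).const_mul 4)).add ((hi 3).const_mul 4)).const_mul B
  have hj := continuous_jap
  have hGc := G.continuous
  refine hwt.mono' (Continuous.aestronglyMeasurable (by fun_prop)) ?_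
  refine Filter.Eventually.of_forall fun p => ?_
  have h1 : |p.1| ≤ ‖p‖ := norm_fst_le p
  have h2 : ‖p.2‖ ≤ ‖p‖ := norm_snd_le p
  have h3 : |p.1 + s * ‖p.2‖| ≤ 2 * ‖p‖ := by
    refine (abs_add_le _ _).trans ?_
    rw [abs_mul, hs, abs_norm]; linarith
  have h4 : (p.1 + s * ‖p.2‖) ^ 2 ≤ 4 * ‖p‖ ^ 2 := by
    rw [← sq_abs]; nlinarith [abs_nonneg (p.1 + s * ‖p.2‖)]
  have h5 : jap ‖p.2‖ ≤ 1 + ‖p‖ := (jap_le_one_add (norm_nonneg _)).trans (by linarith)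
  have h6 := (jap_pos ‖p.2‖).le
  have h7 : ‖G p‖ ^ 2 ≤ B * ‖G p‖ := by
    rw [sq]; exact mul_le_mul_of_nonneg_right (hB p) (norm_nonneg _)
  rw [Real.norm_of_nonneg (by positivity)]
  calc (1 + (p.1 + s * ‖p.2‖) ^ 2) * (jap ‖p.2‖ * ‖G p‖ ^ 2)
      ≤ (1 + 4 * ‖p‖ ^ 2) * ((1 + ‖p‖) * (B * ‖G p‖)) := by gcongr
    _ = _ := by simp only [Pi.add_apply]; ring

/-- The `L²` norm of the `k`-th modulation piece, as it enters the Bourgain–Besov norm. -/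
def pieceNorm (φ : ℝ → ℝ) (s : ℝ) (G : SchwartzMap SpaceTime ℂ) (k : ℕ) : ℝ :=
  l2F fun τ ξ => ((jap ‖ξ‖ ^ (1 / 2 : ℝ) * lpPiece φ k (τ + s * ‖ξ‖) : ℝ) : ℂ) * G (τ, ξ)

lemma integrable_lpPiece_weight {φ : ℝ → ℝ} (hφ : IsLPBump φ) {s : ℝ} (hs : |s| = 1)
    (G : SchwartzMap SpaceTime ℂ) (k : ℕ) :
    Integrable (fun p : SpaceTime =>
      lpPiece φ k (p.1 + s * ‖p.2‖) ^ 2 * (jap ‖p.2‖ * ‖G p‖ ^ 2)) := by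
  have hm := hφ.measurable_lpPiece k
  have hj := continuous_jap.measurable
  have hGc := G.continuous.measurable
  refine (integrable_weight_mul_schwartzMap hs G).mono' ?_ ?_
  · refine Measurable.aestronglyMeasurable ?_
    refine Measurable.mul ((hm.comp ?_).pow_const 2) ?_ <;> fun_prop
  · refine Filter.Eventually.of_forall fun p => ?_
    have h6 := (jap_pos ‖p.2‖).le
    rw [Real.norm_of_nonneg (by positivity)]
    gcongr
    have h1 := hφ.lpPiece_nonneg k (p.1 + s * ‖p.2‖)
    have h2 := hφ.lpPiece_le_one k (p.1 + s * ‖p.2‖)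
    nlinarith [sq_nonneg (p.1 + s * ‖p.2‖)]

lemma sq_pieceNorm {φ : ℝ → ℝ} (hφ : IsLPBump φ) {s : ℝ} (hs : |s| = 1)
    (G : SchwartzMap SpaceTime ℂ) (k : ℕ) :
    pieceNorm φ s G k ^ 2 =
      ∫ p : SpaceTime, lpPiece φ k (p.1 + s * ‖p.2‖) ^ 2 * (jap ‖p.2‖ * ‖G p‖ ^ 2) := by
  have h1 : ∀ τ (ξ : E2),
      ‖((jap ‖ξ‖ ^ (1 / 2 : ℝ) * lpPiece φ k (τ + s * ‖ξ‖) : ℝ) : ℂ) * G (τ, ξ)‖ ^ 2 =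
        lpPiece φ k (τ + s * ‖ξ‖) ^ 2 * (jap ‖ξ‖ * ‖G (τ, ξ)‖ ^ 2) := fun τ ξ => by
    rw [norm_mul, norm_real, mul_pow, Real.norm_eq_abs, sq_abs, mul_pow, ← Real.sqrt_eq_rpow,
      Real.sq_sqrt (jap_pos _).le]
    ring
  have h2 : 0 ≤ ∫ τ : ℝ, ∫ ξ : E2,
      ‖((jap ‖ξ‖ ^ (1 / 2 : ℝ) * lpPiece φ k (τ + s * ‖ξ‖) : ℝ) : ℂ) * G (τ, ξ)‖ ^ 2 :=
    integral_nonneg fun τ => integral_nonneg fun ξ => by positivity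
  rw [pieceNorm, l2F, Real.sq_sqrt h2]
  simp_rw [h1]
  exact (integral_prod _ (integrable_lpPiece_weight hφ hs G k)).symm

lemma weightedSq_lpPiece_mul {φ : ℝ → ℝ} (hφ : IsLPBump φ) {s : ℝ} (hs : |s| = 1)
    (G : SchwartzMap SpaceTime ℂ) (k : ℕ) :
    weightedSq (fun q => (lpPiece φ k q.1 : ℂ) * coneCoord s G q) =
      ENNReal.ofReal (pieceNorm φ s G k ^ 2) := by
  have hwt := integrable_lpPiece_weight hφ hs G k
  have hmp := measurePreserving_coneShear s
  have hwt' : Integrable (fun q => lpPiece φ k ((coneShear s q).1 + s * ‖(coneShear s q).2‖) ^ 2 *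
      (jap ‖(coneShear s q).2‖ * ‖G (coneShear s q)‖ ^ 2)) :=
    hmp.integrable_comp_of_integrable hwt
  rw [sq_pieceNorm hφ hs, ← hmp.integral_comp (coneShear s).measurableEmbedding,
    ofReal_integral_eq_lintegral_ofReal hwt'
      (Filter.Eventually.of_forall fun p => by
        have := (jap_pos ‖(coneShear s p).2‖).le
        positivity),
    weightedSq]
  refine lintegral_congr fun q => ?_
  have h1 : (coneShear s q).1 + s * ‖(coneShear s q).2‖ = q.1 := sub_add_cancel _ _
  have h2 : (coneShear s q).2 = q.2 := rfl
  rw [h1, h2, ← ofReal_norm, ← ENNReal.ofReal_pow (norm_nonneg _),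
    ← ENNReal.ofReal_mul (jap_pos _).le, norm_mul, norm_real, mul_pow, Real.norm_eq_abs, sq_abs]
  congr 1
  rw [coneCoord]
  ring

lemma summable_pieceNorm {φ : ℝ → ℝ} (hφ : IsLPBump φ) {s : ℝ} (hs : |s| = 1)
    (G : SchwartzMap SpaceTime ℂ) :
    Summable fun k : ℕ => (2 : ℝ) ^ ((1 / 3 : ℝ) * k) * pieceNorm φ s G k := by
  set D := ∫ p : SpaceTime, (1 + (p.1 + s * ‖p.2‖) ^ 2) * (jap ‖p.2‖ * ‖G p‖ ^ 2) with hD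
  have hle : ∀ k : ℕ, pieceNorm φ s G (k + 1) ≤ (2 : ℝ)⁻¹ ^ k * √D := fun k => by
    rw [← Real.sqrt_sq (show (0 : ℝ) ≤ 2⁻¹ ^ k by positivity), ← Real.sqrt_mul (by positivity)]
    refine Real.le_sqrt_of_sq_le ?_
    rw [sq_pieceNorm hφ hs, hD, ← integral_const_mul]
    refine integral_mono (integrable_lpPiece_weight hφ hs G _)
      ((integrable_weight_mul_schwartzMap hs G).const_mul _) fun p => ?_
    have h6 := (jap_pos ‖p.2‖).le
    simp only
    rw [← mul_assoc (((2 : ℝ)⁻¹ ^ k) ^ 2)]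
    refine mul_le_mul_of_nonneg_right ?_ (mul_nonneg h6 (sq_nonneg _))
    set l := p.1 + s * ‖p.2‖
    have h1 := hφ.lpPiece_nonneg (k + 1) l
    have h2 := hφ.lpPiece_le_one (k + 1) l
    by_cases h0 : lpPiece φ (k + 1) l = 0
    · rw [h0, zero_pow two_ne_zero]; positivity
    · have h3 := IsLPBump.two_pow_le_of_lpPiece_succ_ne_zero hφ h0
      have h4 : (1 : ℝ) ≤ 2⁻¹ ^ k * |l| := by
        rw [inv_pow, ← div_eq_inv_mul, one_le_div (by positivity)]; exact h3
      have h5 : (1 : ℝ) ≤ (2⁻¹ ^ k) ^ 2 * l ^ 2 := by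
        rw [← sq_abs l, ← mul_pow]; exact one_le_pow₀ h4
      have h7 : (0 : ℝ) ≤ (2⁻¹ ^ k) ^ 2 := by positivity
      nlinarith
  rw [← summable_nat_add_iff 1]
  have hgeo : Summable fun k : ℕ =>
      ((2 : ℝ) ^ (1 / 3 : ℝ) * √D) * ((2 : ℝ) ^ (1 / 3 : ℝ) * 2⁻¹) ^ k := by
    refine (summable_geometric_of_lt_one (by positivity) ?_).mul_left _
    have : (2 : ℝ) ^ (1 / 3 : ℝ) < 2 ^ (1 : ℝ) :=
      Real.rpow_lt_rpow_of_exponent_lt (by norm_num) (by norm_num)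
    rw [Real.rpow_one] at this
    linarith
  refine hgeo.of_nonneg_of_le (fun k => mul_nonneg (by positivity) (Real.sqrt_nonneg _)) fun k => ?_
  have h1 : (2 : ℝ) ^ ((1 / 3 : ℝ) * ((k + 1 : ℕ) : ℝ)) =
      (2 : ℝ) ^ (1 / 3 : ℝ) * ((2 : ℝ) ^ (1 / 3 : ℝ)) ^ k := by
    rw [Real.rpow_mul (by norm_num), Real.rpow_natCast, pow_succ']
  rw [h1, mul_pow]
  calc _ ≤ (2 : ℝ) ^ (1 / 3 : ℝ) * ((2 : ℝ) ^ (1 / 3 : ℝ)) ^ k * ((2 : ℝ)⁻¹ ^ k * √D) := by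
        gcongr; exact hle k
    _ = _ := by ring

/-- Minkowski's inequality in `L³_t L⁶_x` for finite sums. -/
lemma lintegral_lintegral_sum_rpow_le (S : Finset ℕ) {v : ℕ → ℝ → E2 → ℝ≥0∞}
    (hv : ∀ k, Measurable (Function.uncurry (v k))) :
    (∫⁻ t, (∫⁻ x, (∑ k ∈ S, v k t x) ^ (6 : ℝ)) ^ (1 / 2 : ℝ)) ^ (1 / 3 : ℝ) ≤
      ∑ k ∈ S, (∫⁻ t, (∫⁻ x, v k t x ^ (6 : ℝ)) ^ (1 / 2 : ℝ)) ^ (1 / 3 : ℝ) := by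
  have e : ∀ y : ℝ≥0∞, y ^ (1 / 2 : ℝ) = (y ^ (1 / 6 : ℝ)) ^ (3 : ℝ) := fun y => by
    rw [← ENNReal.rpow_mul]; norm_num
  simp_rw [e]
  have hv' : ∀ k t, Measurable (v k t) := fun k t =>
    (hv k).comp (measurable_const.prodMk measurable_id)
  have hm : ∀ k, Measurable fun t => (∫⁻ x, v k t x ^ (6 : ℝ)) ^ (1 / 6 : ℝ) := fun k =>
    (Measurable.lintegral_prod_right' (f := fun z : ℝ × E2 => v k z.1 z.2 ^ (6 : ℝ))
      ((hv k).pow_const _)).pow_const _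
  refine le_trans (ENNReal.rpow_le_rpow (lintegral_mono fun t => ENNReal.rpow_le_rpow
    (lintegral_Lp_sum_le (by norm_num) S fun k => hv' k t) (by norm_num)) (by norm_num)) ?_
  exact lintegral_Lp_sum_le (by norm_num) S hm

/-- The mixed norm is controlled by the corresponding iterated lower Lebesgue integral. -/
lemma mixedNorm_le_of_lintegral_le {f : SpaceTime → ℂ} {Z : ℝ} (hZ : 0 ≤ Z)
    (h : ∫⁻ t, (∫⁻ x, ‖f (t, x)‖ₑ ^ (6 : ℝ)) ^ (1 / 2 : ℝ) ≤ ENNReal.ofReal Z ^ (3 : ℝ)) :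
    mixedNorm 3 6 f ≤ Z := by
  have hin : ∀ t, 0 ≤ ∫ x : E2, ‖f (t, x)‖ ^ (6 : ℝ) := fun t =>
    integral_nonneg fun x => by positivity
  have hout : 0 ≤ ∫ t : ℝ, (∫ x : E2, ‖f (t, x)‖ ^ (6 : ℝ)) ^ (3 / 6 : ℝ) :=
    integral_nonneg fun t => Real.rpow_nonneg (hin t) _
  have h1 : ∀ t, ‖(∫ x : E2, ‖f (t, x)‖ ^ (6 : ℝ)) ^ (3 / 6 : ℝ)‖ₑ ≤
      (∫⁻ x, ‖f (t, x)‖ₑ ^ (6 : ℝ)) ^ (1 / 2 : ℝ) := fun t => by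
    rw [Real.enorm_of_nonneg (Real.rpow_nonneg (hin t) _),
      ← ENNReal.ofReal_rpow_of_nonneg (hin t) (by norm_num), show (3 / 6 : ℝ) = 1 / 2 by norm_num]
    refine ENNReal.rpow_le_rpow ?_ (by norm_num)
    rw [← Real.enorm_of_nonneg (hin t)]
    refine (enorm_integral_le_lintegral_enorm _).trans (lintegral_mono fun x => ?_)
    rw [Real.enorm_of_nonneg (by positivity),
      ← ENNReal.ofReal_rpow_of_nonneg (norm_nonneg _) (by norm_num), ofReal_norm]
  have h2 : ENNReal.ofReal (∫ t : ℝ, (∫ x : E2, ‖f (t, x)‖ ^ (6 : ℝ)) ^ (3 / 6 : ℝ)) ≤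
      ENNReal.ofReal (Z ^ (3 : ℝ)) := by
    rw [← ENNReal.ofReal_rpow_of_nonneg hZ (by norm_num), ← Real.enorm_of_nonneg hout]
    exact (enorm_integral_le_lintegral_enorm _).trans ((lintegral_mono h1).trans h)
  rw [ENNReal.ofReal_le_ofReal_iff (by positivity)] at h2
  calc mixedNorm 3 6 f ≤ (Z ^ (3 : ℝ)) ^ (1 / 3 : ℝ) :=
        Real.rpow_le_rpow hout h2 (by norm_num)
    _ = Z := by rw [← Real.rpow_mul hZ]; norm_num

lemma exists_lintegral_coneCoord_le :
    ∃ c : ℝ, 0 < c ∧ ∀ φ : ℝ → ℝ, IsLPBump φ → ∀ s : ℝ, |s| = 1 →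
      ∀ G : SchwartzMap SpaceTime ℂ,
        ∫⁻ t, (∫⁻ x, ‖waveIntegral s (coneCoord s G) t x‖ₑ ^ (6 : ℝ)) ^ (1 / 2 : ℝ) ≤
          ENNReal.ofReal (c * ∑' k : ℕ, (2 : ℝ) ^ ((1 / 3 : ℝ) * k) * pieceNorm φ s G k) ^
            (3 : ℝ) := by
  obtain ⟨C, hC, hCle⟩ := exists_lintegral_waveIntegral_le
  refine ⟨C ^ (1 / 3 : ℝ), by positivity, fun φ hφ s hs G => ?_⟩
  set a : ℕ → ℝ := pieceNorm φ s G with ha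
  have ha0 : ∀ k, 0 ≤ a k := fun k => Real.sqrt_nonneg _
  set b : ℕ → ℝ := fun k => C ^ (1 / 3 : ℝ) * ((2 : ℝ) ^ ((1 / 3 : ℝ) * k) * a k) with hb
  have hb0 : ∀ k, 0 ≤ b k := fun k =>
    mul_nonneg (by positivity) (mul_nonneg (by positivity) (ha0 k))
  have hbs : Summable b := (summable_pieceNorm hφ hs G).mul_left _
  have hbsum : C ^ (1 / 3 : ℝ) * ∑' k : ℕ, (2 : ℝ) ^ ((1 / 3 : ℝ) * k) * a k = ∑' k, b k :=
    tsum_mul_left.symm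
  have hbcube : ∀ k, C * 2 ^ k * a k ^ 3 = b k ^ (3 : ℝ) := fun k => by
    have h1 : (C ^ (1 / 3 : ℝ)) ^ 3 = C := by
      rw [← Real.rpow_natCast, ← Real.rpow_mul hC.le]; norm_num
    have h2 : ((2 : ℝ) ^ ((1 / 3 : ℝ) * k)) ^ 3 = 2 ^ k := by
      rw [← Real.rpow_natCast, ← Real.rpow_mul (by norm_num), ← Real.rpow_natCast]
      congr 1; push_cast; ring
    rw [show (3 : ℝ) = (3 : ℕ) by norm_num, Real.rpow_natCast, hb, mul_pow, mul_pow, h1, h2,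
      mul_assoc]
  set Γ := coneCoord s G
  have hΓi : Integrable Γ := integrable_coneCoord s G
  have hΓm : Measurable Γ := (continuous_coneCoord s G).measurable
  set g : ℕ → ℝ × E2 → ℂ := fun k q => (lpPiece φ k q.1 : ℂ) * Γ q with hg
  have hpm : ∀ k, Measurable fun q : ℝ × E2 => (lpPiece φ k q.1 : ℂ) := fun k =>
    measurable_ofReal.comp ((hφ.measurable_lpPiece k).comp measurable_fst)
  have hgm : ∀ k, Measurable (g k) := fun k => (hpm k).mul hΓm
  have hgi : ∀ k, Integrable (g k) := fun k =>
    hΓi.bdd_mul (c := 1) (hpm k).aestronglyMeasurable (ae_of_all _ fun q => by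
      rw [norm_real, Real.norm_of_nonneg (hφ.lpPiece_nonneg k _)]
      exact hφ.lpPiece_le_one k _)
  have hpiece : ∀ k,
      (∫⁻ t, (∫⁻ x, ‖waveIntegral s (g k) t x‖ₑ ^ (6 : ℝ)) ^ (1 / 2 : ℝ)) ^ (1 / 3 : ℝ) ≤
        ENNReal.ofReal (b k) := fun k => by
    have h1 := hCle s hs (2 ^ k) (by positivity) (g k) (hgm k) (hgi k)
      (fun q hq => IsLPBump.abs_le_of_lpPiece_ne_zero hφ fun h0 => hq (by simp [hg, h0]))
      (a k) (ha0 k) (weightedSq_lpPiece_mul hφ hs G k).le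
    rw [hbcube, ← ENNReal.ofReal_rpow_of_nonneg (hb0 k) (by norm_num)] at h1
    refine (ENNReal.rpow_le_rpow h1 (by norm_num)).trans (le_of_eq ?_)
    rw [← ENNReal.rpow_mul]; norm_num
  have hwm : ∀ k, Measurable (Function.uncurry fun t x => ‖waveIntegral s (g k) t x‖ₑ) := fun k =>
    (continuous_waveIntegral s (hgi k)).measurable.enorm
  have hsumi : ∀ M, Integrable fun q => ∑ k ∈ Finset.range M, g k q := fun M =>
    integrable_finsetSum _ fun k _ => hgi k
  have hsumg : ∀ M q, ∑ k ∈ Finset.range M, g k q =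
      ((∑ k ∈ Finset.range M, lpPiece φ k q.1 : ℝ) : ℂ) * Γ q := fun M q => by
    rw [ofReal_sum, Finset.sum_mul]
  rw [hbsum]
  refine lintegral_lintegral_rpow_le_of_tendsto
    (F := fun M t x => ‖waveIntegral s (fun q => ∑ k ∈ Finset.range M, g k q) t x‖ₑ)
    (fun M => (continuous_waveIntegral s (hsumi M)).measurable.enorm) (fun t x => ?_)
    (by norm_num) fun M => ?_
  · refine (tendsto_waveIntegral s hΓi hsumi (fun M q => ?_) (fun q => ?_) t x).enorm
    · rw [hsumg, norm_mul, norm_real, Real.norm_of_nonneg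
        (Finset.sum_nonneg fun k _ => hφ.lpPiece_nonneg k _)]
      exact mul_le_of_le_one_left (norm_nonneg _) (hφ.sum_lpPiece_le_one M _)
    · simp_rw [hsumg]
      have h1 := (continuous_ofReal.tendsto _).comp (hφ.hasSum_lpPiece q.1).tendsto_sum_nat
      simpa using h1.mul_const (Γ q)
  · have h1 : (∫⁻ t, (∫⁻ x, ‖waveIntegral s (fun q => ∑ k ∈ Finset.range M, g k q) t x‖ₑ
        ^ (6 : ℝ)) ^ (1 / 2 : ℝ)) ^ (1 / 3 : ℝ) ≤ ENNReal.ofReal (∑' k, b k) := by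
      calc _ ≤ (∫⁻ t, (∫⁻ x, (∑ k ∈ Finset.range M, ‖waveIntegral s (g k) t x‖ₑ)
            ^ (6 : ℝ)) ^ (1 / 2 : ℝ)) ^ (1 / 3 : ℝ) := by
            gcongr with t x
            rw [← sum_waveIntegral _ s hgi]
            exact enorm_sum_le _ _
        _ ≤ ∑ k ∈ Finset.range M, ENNReal.ofReal (b k) :=
            (lintegral_lintegral_sum_rpow_le _ hwm).trans (Finset.sum_le_sum fun k _ => hpiece k)
        _ = ENNReal.ofReal (∑ k ∈ Finset.range M, b k) :=
            (ENNReal.ofReal_sum_of_nonneg fun k _ => hb0 k).symm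
        _ ≤ _ := ENNReal.ofReal_le_ofReal (hbs.sum_le_tsum _ fun k _ => hb0 k)
    have h2 := ENNReal.rpow_le_rpow h1 (show (0 : ℝ) ≤ 3 by norm_num)
    rw [← ENNReal.rpow_mul] at h2
    simpa using h2

/-- There is c > 0 such that for every sign s ∈ {+1,−1} and every Schwartz f on ℝ×ℝ²:
    ‖f‖_{L³_t L⁶_x} ≤ c ‖f‖_{X^{1/2,1/3,1}_s}. -/
theorem L3L6_le_XnormB :
    ∀ φ : ℝ → ℝ, IsLPBump φ →
      ∃ c : ℝ, 0 < c ∧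
        ∀ s : ℝ, (s = 1 ∨ s = -1) →
          ∀ f : SchwartzMap SpaceTime ℂ,
            mixedNorm 3 6 (fun p => f p) ≤ c * XnormB φ (1 / 2) (1 / 3) s (fun p => f p) := by
  intro φ hφ
  obtain ⟨c, hc, hle⟩ := exists_lintegral_coneCoord_le
  refine ⟨c, hc, fun s hs f => ?_⟩
  have hs1 : |s| = 1 := by rcases hs with rfl | rfl <;> simp
  obtain ⟨G, hG, hf⟩ := exists_schwartzMap_eq_ftST f
  have hX : XnormB φ (1 / 2) (1 / 3) s (fun p => f p) =
      ∑' k : ℕ, (2 : ℝ) ^ ((1 / 3 : ℝ) * k) * pieceNorm φ s G k := by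
    simp only [XnormB, hG, pieceNorm]
  rw [hX]
  refine mixedNorm_le_of_lintegral_le (mul_nonneg hc.le (tsum_nonneg fun k =>
    mul_nonneg (by positivity) (Real.sqrt_nonneg _))) ((lintegral_mono fun t => ?_).trans
      (hle φ hφ s hs1 G))
  gcongr with x
  rw [hf, integral_exp_mul_eq_waveIntegral s, enorm_mul]
  refine mul_le_of_le_one_left (zero_le) ?_
  have h1 : (1 : ℝ) ≤ (2 * Real.pi) ^ 3 := one_le_pow₀ (by linarith [Real.pi_gt_three])
  rw [← ofReal_norm, norm_real, Real.norm_of_nonneg (by positivity), ENNReal.ofReal_le_one]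
  exact inv_le_one_of_one_le₀ h1
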